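/- Let X ⊆ A^ℤ be an aperiodic Toeplitz subshift. Then X is a strong Toeplitz subshift of rank 2 if and only if for every positive integer p dividing the scale of X and every m ∈ ℕ there exist positive integers q, r and words u, v over A such that: (i) |u| = |v| = q; (ii) p | q, q divides the scale of X, and q < r; (iii) the maximal common prefix and the maximal common suffix of u and v both have length greater than m; and (iv) every word in L_{2r}(X) ∪ L_{4r}(X) is uniquely built from {u,v}. -/

import Mathlib

namespace ToeplitzFR

open Set

variable {A B C : Type*}

/-- The shift map `S` on `ℤ → A`: `S(x)(i) = x(i+1)`. -/
def shift (x : ℤ → A) : ℤ → A := fun i => x (i + 1)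

/-- The inverse shift map `S⁻¹`. -/
def shiftInv (x : ℤ → A) : ℤ → A := fun i => x (i - 1)

/-- The shift by `k`: `S^k`. -/
def shiftBy (k : ℤ) (x : ℤ → A) : ℤ → A := fun i => x (i + k)

/-- The finite word `x[i, i+n)`. -/
def factorAt (x : ℤ → A) (i : ℤ) (n : ℕ) : List A :=
  (List.range n).map fun j => x (i + j)

/-- `x` is a periodic point of the shift. -/
def IsPeriodicPoint (x : ℤ → A) : Prop := ∃ p : ℕ, 0 < p ∧ ∀ i : ℤ, x (i + p) = x i

def IsAperiodicPoint (x : ℤ → A) : Prop := ¬ IsPeriodicPoint x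

/-- `Per_p(x)`. -/
def PerSet (x : ℤ → A) (p : ℕ) : Set ℤ := {i : ℤ | ∀ k : ℤ, x (i + k * p) = x i}

/-- `Per(x) = ⋃_{p>1} Per_p(x)`. -/
def PerAll (x : ℤ → A) : Set ℤ := {i : ℤ | ∃ p : ℕ, 1 < p ∧ i ∈ PerSet x p}

/-- `x` is a Toeplitz sequence. -/
def IsToeplitz (x : ℤ → A) : Prop := ∀ i : ℤ, ∃ p : ℕ, 1 < p ∧ i ∈ PerSet x p

/-- The shift orbit of `x`. -/
def orbit (x : ℤ → A) : Set (ℤ → A) := {y | ∃ k : ℤ, y = shiftBy k x}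

/-- `X` is the Toeplitz subshift generated by the Toeplitz sequence `x`. -/
def ToeplitzGenerates [TopologicalSpace A] (x : ℤ → A) (X : Set (ℤ → A)) : Prop :=
  IsToeplitz x ∧ X = closure (orbit x)

/-- `X` is a Toeplitz subshift. -/
def IsToeplitzSubshift [TopologicalSpace A] (X : Set (ℤ → A)) : Prop :=
  ∃ x : ℤ → A, ToeplitzGenerates x X

/-- The `p`-skeleton of `x`, with `none` as the blank symbol. -/
noncomputable def Skel (x : ℤ → A) (p : ℕ) : ℤ → Option A :=
  fun i => @ite _ (i ∈ PerSet x p) (Classical.dec _) (some (x i)) none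

/-- `p` is an essential period of `x`. -/
def IsEssentialPeriod (x : ℤ → A) (p : ℕ) : Prop :=
  1 < p ∧ ∀ q : ℕ, 0 < q → q < p → ∃ i : ℤ, Skel x p (i + q) ≠ Skel x p i

/-- `(P n)` is a period structure for `x`. -/
def IsPeriodStructure (x : ℤ → A) (P : ℕ → ℕ) : Prop :=
  StrictMono P ∧ (∀ n, IsEssentialPeriod x (P n)) ∧ (∀ n, P n ∣ P (n+1)) ∧
    ∀ i : ℤ, ∃ n, i ∈ PerSet x (P n)

/-- `q` divides the scale of the Toeplitz subshift `X`. -/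
def DividesScale [TopologicalSpace A] (X : Set (ℤ → A)) (q : ℕ) : Prop :=
  ∃ (x : ℤ → A) (P : ℕ → ℕ),
    ToeplitzGenerates x X ∧ IsPeriodStructure x P ∧ ∃ n, q ∣ P n

/-! ### Directive sequences and S-adic subshifts -/

/-- All morphisms in the directive sequence are non-erasing. -/
def NonErasing {A : ℕ → Type*} (τ : ∀ n, A (n+1) → List (A n)) : Prop :=
  ∀ n a, τ n a ≠ []

/-- The directive sequence has constant length. -/
def ConstantLength {A : ℕ → Type*} (τ : ∀ n, A (n+1) → List (A n)) : Prop :=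
  ∀ n, ∀ a b : A (n+1), (τ n a).length = (τ n b).length

/-- The directive sequence is proper. -/
def ProperSeq {A : ℕ → Type*} (τ : ∀ n, A (n+1) → List (A n)) : Prop :=
  ∀ n, ∃ b c : A n, ∀ a : A (n+1), (τ n a).head? = some b ∧ (τ n a).getLast? = some c

/-- `sadicWordAux τ n k a = τ_{[n, n+k)}(a)`. -/
def sadicWordAux {A : ℕ → Type*} (τ : ∀ n, A (n+1) → List (A n)) (n : ℕ) :
    ∀ k : ℕ, A (n + k) → List (A n)
  | 0, a => [a]
  | (k+1), a => (τ (n+k) a).flatMap (sadicWordAux τ n k)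

/-- `word0 τ k a = τ_{[0, k)}(a)` for `a ∈ A k`. -/
def word0 {A : ℕ → Type*} (τ : ∀ n, A (n+1) → List (A n)) :
    ∀ k : ℕ, A k → List (A 0)
  | 0, a => [a]
  | (k+1), a => (τ k a).flatMap (word0 τ k)

/-- The directive sequence is primitive. -/
def PrimitiveSeq {A : ℕ → Type*} (τ : ∀ n, A (n+1) → List (A n)) : Prop :=
  ∀ n, ∃ k : ℕ, 0 < k ∧ ∀ (a : A (n+k)) (b : A n), b ∈ sadicWordAux τ n k a

/-- The `n`-th level `X_τ^{(n)}` of the S-adic system generated by `τ`. -/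
def XLevel {A : ℕ → Type*} (τ : ∀ n, A (n+1) → List (A n)) (n : ℕ) :
    Set (ℤ → A n) :=
  {y | ∀ (i : ℤ) (m : ℕ), ∃ k : ℕ, 0 < k ∧ ∃ a : A (n+k),
      (factorAt y i m).IsInfix (sadicWordAux τ n k a)}

/-- The alphabet rank (`liminf_n |A_n|`) is at most `K`. -/
def AlphabetRankLE (A : ℕ → Type*) [∀ n, Fintype (A n)] (K : ℕ) : Prop :=
  ∀ N : ℕ, ∃ n, N ≤ n ∧ Fintype.card (A n) ≤ K

/-! ### Recognizability -/

/-- `z` is the bi-infinite concatenation `⋯σ(y(-1)).σ(y(0))σ(y(1))⋯`,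
with `σ(y(0))` starting at coordinate `0`. -/
def IsConcat (σ : B → List C) (y : ℤ → B) (z : ℤ → C) : Prop :=
  ∃ c : ℤ → ℤ, c 0 = 0 ∧ (∀ j : ℤ, c (j + 1) = c j + (σ (y j)).length) ∧
    ∀ (j : ℤ) (m : Fin (σ (y j)).length), z (c j + (m : ℕ)) = (σ (y j)).get m

/-- `(y, k)` is a centered `σ`-representation of `x` in `Y`. -/
def IsCenteredRep (σ : B → List C) (Y : Set (ℤ → B)) (x : ℤ → C)
    (y : ℤ → B) (k : ℕ) : Prop :=
  y ∈ Y ∧ k < (σ (y 0)).length ∧ IsConcat σ y (fun m => x (m - k))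

/-- The morphism `σ` is recognizable in `Y`. -/
def RecognizableIn (σ : B → List C) (Y : Set (ℤ → B)) : Prop :=
  ∀ (x : ℤ → C) (y y' : ℤ → B) (k k' : ℕ),
    IsCenteredRep σ Y x y k → IsCenteredRep σ Y x y' k' → y = y' ∧ k = k'

/-- The directive sequence `τ` is recognizable. -/
def RecognizableSeq {A : ℕ → Type*} (τ : ∀ n, A (n+1) → List (A n)) : Prop :=
  ∀ n, RecognizableIn (τ n) (XLevel τ (n+1))

/-! ### Conjugacy -/

/-- `(X, TX)` and `(Y, TY)` are conjugate via a homeomorphism. -/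
def ConjugateBy [TopologicalSpace A] [TopologicalSpace B]
    (X : Set (ℤ → A)) (Y : Set (ℤ → B))
    (TX : (ℤ → A) → (ℤ → A)) (TY : (ℤ → B) → (ℤ → B)) : Prop :=
  ∃ φ : ↥X ≃ₜ ↥Y, ∀ (x : ℤ → A) (hx : x ∈ X) (hx' : TX x ∈ X),
    (φ ⟨TX x, hx'⟩).1 = TY (φ ⟨x, hx⟩).1

/-- `(X, S)` and `(Y, S)` are conjugate subshifts. -/
def Conjugate [TopologicalSpace A] [TopologicalSpace B]
    (X : Set (ℤ → A)) (Y : Set (ℤ → B)) : Prop :=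
  ConjugateBy X Y shift shift

/-- `X` is a strong Toeplitz subshift of rank `K`: it is conjugate to the S-adic subshift
of a constant-length, primitive, proper and recognizable directive sequence of
alphabet rank at most `K`. -/
def IsStrongToeplitzOfRank [TopologicalSpace A] (X : Set (ℤ → A)) (K : ℕ) : Prop :=
  ∃ (B : ℕ → Type) (iB : ∀ n, Fintype (B n)) (σ : ∀ n, B (n+1) → List (B n)),
    NonErasing σ ∧ ConstantLength σ ∧ PrimitiveSeq σ ∧ ProperSeq σ ∧
    RecognizableSeq σ ∧ @AlphabetRankLE B iB K ∧
    @Conjugate A (B 0) _ ⊥ X (XLevel σ 0)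

/-- `X` is conjugate to the S-adic subshift of a primitive, proper and recognizable
directive sequence of alphabet rank at most `K`. -/
def HasFiniteRankSAdicRep [TopologicalSpace A] (X : Set (ℤ → A)) (K : ℕ) : Prop :=
  ∃ (B : ℕ → Type) (iB : ∀ n, Fintype (B n)) (σ : ∀ n, B (n+1) → List (B n)),
    NonErasing σ ∧ PrimitiveSeq σ ∧ ProperSeq σ ∧
    RecognizableSeq σ ∧ @AlphabetRankLE B iB K ∧
    @Conjugate A (B 0) _ ⊥ X (XLevel σ 0)

/-! ### Cuts, languages, built-from -/

/-- The set of words `{x[t+kp, t+(k+1)p) : k ∈ ℤ}`. -/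
def cutWords (x : ℤ → A) (p t : ℕ) : Set (List A) :=
  {w | ∃ k : ℤ, w = factorAt x ((t : ℤ) + k * p) p}

/-- `(p, t)` is a strong rank-2 cut of `x`. -/
def StrongRank2Cut (x : ℤ → A) (p t : ℕ) : Prop :=
  t < p ∧ ∃ u v : List A, u ≠ v ∧ cutWords x p t = {u, v}

/-- The language `L_n(X)`. -/
def Lang (n : ℕ) (X : Set (ℤ → A)) : Set (List A) :=
  {w | ∃ x ∈ X, ∃ i : ℤ, w = factorAt x i n}

/-- The maximal common prefix of `u` and `v` has length greater than `m`. -/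
def CommonPrefixLongerThan (u v : List A) (m : ℕ) : Prop :=
  m + 1 ≤ u.length ∧ m + 1 ≤ v.length ∧ u.take (m+1) = v.take (m+1)

/-- The maximal common suffix of `u` and `v` has length greater than `m`. -/
def CommonSuffixLongerThan (u v : List A) (m : ℕ) : Prop :=
  CommonPrefixLongerThan u.reverse v.reverse m

/-- `b = (β₀, (α₁, …, α_k), β₁)` is a building of the word `w` from `W`:
`w = β₀α₁⋯α_kβ₁`, all `αᵢ ∈ W`, `β₀` is a proper suffix of an element of `W`,
and `β₁` is a proper prefix of an element of `W`. -/
def IsBuilding (W : Set (List A)) (w : List A)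
    (b : List A × List (List A) × List A) : Prop :=
  w = b.1 ++ b.2.1.flatten ++ b.2.2 ∧ (∀ α ∈ b.2.1, α ∈ W) ∧
  (∃ u ∈ W, b.1 <:+ u ∧ b.1 ≠ u) ∧ (∃ u ∈ W, b.2.2 <+: u ∧ b.2.2 ≠ u)

/-- `w` is uniquely built from `W`. -/
def UniquelyBuiltFrom (W : Set (List A)) (w : List A) : Prop :=
  ∃! b : List A × List (List A) × List A, IsBuilding W w b

/-- `X` together with one of its points satisfies the strong rank-2 cut property. -/
def GoodCuts [TopologicalSpace A] (X : Set (ℤ → A)) (x : ℤ → A) : Prop :=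
  ∀ p : ℕ, 0 < p → DividesScale X p → ∀ m : ℕ,
    ∃ q t : ℕ, StrongRank2Cut x q t ∧ p ∣ q ∧ DividesScale X q ∧
      ∃ u v : List A, u ≠ v ∧ cutWords x q t = {u, v} ∧
        CommonPrefixLongerThan u v m ∧ CommonSuffixLongerThan u v m

/-! ### Euclidean pairs and buildings of bi-infinite sequences -/

/-- `{u, v}` is a Euclidean pair. -/
def EuclideanPair (u v : List A) : Prop :=
  ∃ (w : List A) (k l : ℕ),
    u = (List.replicate k w).flatten ∧ v = (List.replicate l w).flatten

/-- `α` is the distinguished prefix of `u` and `v`. -/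
def IsDistinguishedPrefix (u v α : List A) : Prop :=
  α.length < u.length + v.length ∧
  ∀ x y : List A,
    (∃ l : List (List A), (∀ w ∈ l, w = u ∨ w = v) ∧ x = u ++ l.flatten) →
    (∃ l : List (List A), (∀ w ∈ l, w = u ∨ w = v) ∧ y = v ++ l.flatten) →
    α.length + 1 ≤ x.length → α.length + 1 ≤ y.length →
    α <+: x ∧ α <+: y ∧ x[α.length]? ≠ y[α.length]?

/-- `β` is the distinguished suffix of `u` and `v`. -/
def IsDistinguishedSuffix (u v β : List A) : Prop :=
  IsDistinguishedPrefix u.reverse v.reverse β.reverse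

/-- `(c, f)` is a building of the bi-infinite sequence `x` from `W`:
block `j` starts at position `c j` and carries the word `f j ∈ W`. -/
def IsBuildingSeq (W : Set (List A)) (x : ℤ → A) (c : ℤ → ℤ) (f : ℤ → List A) : Prop :=
  (∀ j : ℤ, f j ∈ W) ∧ (∀ j : ℤ, c (j + 1) = c j + (f j).length) ∧
  ∀ (j : ℤ) (m : Fin (f j).length), x (c j + (m : ℕ)) = (f j).get m

/-- The subshift `X_{u,v}` of all sequences built from `{u, v}`. -/
def Xuv (u v : List A) : Set (ℤ → A) :=
  {x | ∃ (c : ℤ → ℤ) (f : ℤ → List A), IsBuildingSeq {u, v} x c f}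

/-! ### Block-code conjugacies -/

/-- A conjugacy `φ : X → Y` admitting block width `2n+1`. -/
structure BlockConjugacy (A : Type*) (X Y : Set (ℤ → A)) (n : ℕ) where
  toFun : (ℤ → A) → (ℤ → A)
  invFun : (ℤ → A) → (ℤ → A)
  maps_to : ∀ x ∈ X, toFun x ∈ Y
  maps_from : ∀ y ∈ Y, invFun y ∈ X
  left_inv : ∀ x ∈ X, invFun (toFun x) = x
  right_inv : ∀ y ∈ Y, toFun (invFun y) = y
  shift_comm : ∀ x ∈ X, toFun (shift x) = shift (toFun x)
  code : List A → A
  code_inv : List A → A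
  code_spec : ∀ x ∈ X, ∀ i : ℤ, toFun x i = code (factorAt x (i - n) (2*n+1))
  code_inv_spec : ∀ y ∈ Y, ∀ i : ℤ, invFun y i = code_inv (factorAt y (i - n) (2*n+1))

/-! ### Parts, permutation action, χ -/

/-- `W` is a member of `Parts(X, p)`: a class of the common-`p`-skeleton relation. -/
def SkelClass (X : Set (ℤ → A)) (p : ℕ) (W : Set (ℤ → A)) : Prop :=
  ∃ y ∈ X, W = {z ∈ X | Skel z p = Skel y p}

/-- The map `ψ̂` induced by a permutation `ψ` of `A^p`. -/
def permHat (p : ℕ) (ψ : Equiv.Perm (Fin p → A)) (x : ℤ → A) : ℤ → A :=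
  fun i =>
    if h : (i.emod p).toNat < p then
      ψ (fun m : Fin p => x (i - i.emod p + (m : ℕ))) ⟨(i.emod p).toNat, h⟩
    else x i

/-- The relation `E_p` on compact subsets of `A^ℤ`. -/
def EpRel (p : ℕ) (K L : Set (ℤ → A)) : Prop :=
  ∃ ψ : Equiv.Perm (Fin p → A), L = permHat p ψ '' K

/-- `W ∈ Parts_*(X, p)`. -/
def SkelClassStar (X : Set (ℤ → A)) (p : ℕ) (W : Set (ℤ → A)) : Prop :=
  SkelClass X p W ∧ ∀ y ∈ W, Skel y p (-1) = none ∧ Skel y p 0 ≠ none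

/-- `length(W) = L` for `W ∈ Parts_*(X, p)`. -/
def HasLength (p : ℕ) (W : Set (ℤ → A)) (L : ℕ) : Prop :=
  ∀ y ∈ W, (∀ i : ℕ, i < L → Skel y p (i : ℤ) ≠ none) ∧ Skel y p (L : ℤ) = none

/-- `Z ∈ χ(X, p)`. -/
def ChiMem (X : Set (ℤ → A)) (p : ℕ) (Z : Set (ℤ → A)) : Prop :=
  ∃ (W : Set (ℤ → A)) (L : ℕ), SkelClassStar X p W ∧ HasLength p W L ∧
    (∀ (W' : Set (ℤ → A)) (L' : ℕ),
      SkelClassStar X p W' → HasLength p W' L' → L' ≤ L) ∧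
    Z = shiftBy ((L / 2 : ℕ) : ℤ) '' W

/-- `χ(X, p) E_p^fin χ(Y, p)`. -/
def ChiEpFin (X Y : Set (ℤ → A)) (p : ℕ) : Prop :=
  (∀ K, ChiMem X p K → ∃ L, ChiMem Y p L ∧ EpRel p K L) ∧
  (∀ L, ChiMem Y p L → ∃ K, ChiMem X p K ∧ EpRel p K L)

/-! ### Single holes and fillings -/

/-- The Toeplitz sequence `x` has single holes with respect to the period structure `P`. -/
def SingleHoles (x : ℤ → A) (P : ℕ → ℕ) : Prop :=
  IsPeriodStructure x P ∧
  ∀ n, ∃! i : ℤ, 0 ≤ i ∧ i < (P n : ℤ) ∧ i ∉ PerSet x (P n)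

/-- The Toeplitz subshift `X` has single holes. -/
def HasSingleHoles [TopologicalSpace A] (X : Set (ℤ → A)) : Prop :=
  ∃ (x : ℤ → A) (P : ℕ → ℕ), ToeplitzGenerates x X ∧ SingleHoles x P

/-- `w` is the `(n, m)`-filling of `x` (for periods `pn < pm`). -/
def IsFilling (x : ℤ → A) (pn pm : ℕ) (w : List A) : Prop :=
  w.length = pm / pn - 1 ∧
  ∀ h : ℤ, 0 ≤ h → h < (pm : ℤ) → h ∉ PerSet x pm →
    ∀ (j : ℕ) (hj : j < w.length), w.get ⟨j, hj⟩ = x (h + (j+1) * pn)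

/-- `u` is a `θ`-palindrome. -/
def ThetaPalindrome (θ : Equiv.Perm A) (u : List A) : Prop :=
  u.map (fun a => θ a) = u.reverse

/-! ### Nice symmetries -/

/-- `x` has nice symmetries with respect to `(p, q)`. -/
def NiceSymmetries (x : ℤ → A) (p q : ℕ) : Prop :=
  ∃ m : ℤ, 1 < m ∧ m ≤ (q : ℤ) + 1 ∧
    (∀ k : ℕ, k < q / p →
      (Set.Ico ((k * p : ℕ) : ℤ) (((k+1) * p : ℕ) : ℤ) ⊆ PerSet x q ↔
       Set.Ico (m - ((k+1) * p : ℕ)) (m - (k * p : ℕ)) ⊆ PerSet x q)) ∧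
    (∀ k k' : ℕ, k < q / p → k' < q / p →
      Set.Ico ((k * p : ℕ) : ℤ) (((k+1) * p : ℕ) : ℤ) ⊆ PerSet x q →
      Set.Ico ((k' * p : ℕ) : ℤ) (((k'+1) * p : ℕ) : ℤ) ⊆ PerSet x q →
      (factorAt x ((k * p : ℕ) : ℤ) p = factorAt x ((k' * p : ℕ) : ℤ) p ↔
       factorAt x (m - ((k+1) * p : ℕ)) p = factorAt x (m - ((k'+1) * p : ℕ)) p))

/-- For some `p` dividing the scale of `X`, `x` has nice symmetries with respect to
`(p, q)` for all `q > p` with `p ∣ q` dividing the scale of `X`. -/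
def NiceSymAll [TopologicalSpace A] (X : Set (ℤ → A)) (x : ℤ → A) : Prop :=
  ∃ p : ℕ, 0 < p ∧ DividesScale X p ∧
    ∀ q : ℕ, p < q → p ∣ q → DividesScale X q → NiceSymmetries x p q

/-- A pair `(x, x')` is a centered left asymptotic pair. -/
def CenteredLeftAsymptoticPair (x x' : ℤ → A) : Prop :=
  (∀ i : ℤ, i < 0 → x i = x' i) ∧ x 0 ≠ x' 0

/-! ### Automorphism groups -/

/-- `e` is an automorphism of the subshift `(X, S)`. -/
def IsShiftAutomorphism [TopologicalSpace A] (X : Set (ℤ → A)) (e : ↥X ≃ₜ ↥X) : Prop :=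
  ∀ (x : ℤ → A) (hx : x ∈ X) (hx' : shift x ∈ X),
    (e ⟨shift x, hx'⟩).1 = shift (e ⟨x, hx⟩).1

/-- The automorphism group of `(X, S)` is isomorphic, as a group, to `ℤ × ℤ/nℤ`. -/
def AutGroupIsoZxZmod [TopologicalSpace A] (X : Set (ℤ → A)) (n : ℕ) : Prop :=
  ∃ Φ : {e : ↥X ≃ₜ ↥X // IsShiftAutomorphism X e} → ℤ × ZMod n,
    Function.Bijective Φ ∧
    ∀ e f g : {e : ↥X ≃ₜ ↥X // IsShiftAutomorphism X e},
      (∀ z : ↥X, g.1 z = e.1 (f.1 z)) → Φ g = Φ e + Φ f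

/-! ### The Polish space of subshifts over `ℤ` -/

/-- A point of the space `𝐒` of all (compact, nonempty, shift-invariant) subshifts
over finite alphabets contained in `ℤ`. -/
structure SubshiftSpace : Type where
  carrier : Set (ℤ → ℤ)
  nonempty : carrier.Nonempty
  compact : IsCompact carrier
  invariant : shift '' carrier = carrier

/-- The topology on `𝐒` induced by the languages `(L_n(X))_{n}`, with each
family of `n`-languages discrete; this coincides with the metric
`d(X,Y) = 2^{-min{n : L_n(X) ≠ L_n(Y)}}`. -/
instance : TopologicalSpace SubshiftSpace :=
  TopologicalSpace.induced
    (fun X : SubshiftSpace => (fun n => Lang n X.carrier : ℕ → Set (List ℤ)))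
    (@Pi.topologicalSpace ℕ (fun _ => Set (List ℤ)) (fun _ => ⊥))

/-- The subset `𝐌 ⊆ 𝐒` of infinite minimal subshifts. -/
def MinimalSet : Set SubshiftSpace :=
  {X | X.carrier.Infinite ∧ ∀ x ∈ X.carrier, X.carrier ⊆ closure (orbit x)}


/-! ### Factors -/

theorem factorAt_def (x : ℤ → A) (i : ℤ) (n : ℕ) :
    factorAt x i n = (List.range n).map (fun j : ℕ => x (i + (j : ℤ))) := by
  have : ∀ l : List ℕ, (do let a ← l; pure (a : ℤ) : List ℤ) = l.map (fun a : ℕ => (a : ℤ)) := by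
    intro l
    induction l with
    | nil => rfl
    | cons a l ih => simp_all
  unfold factorAt
  rw [this, List.map_map]
  rfl

theorem factorAt_length (x : ℤ → A) (i : ℤ) (n : ℕ) : (factorAt x i n).length = n := by
  simp [factorAt_def]

theorem factorAt_getElem (x : ℤ → A) (i : ℤ) (n t : ℕ) (h : t < (factorAt x i n).length) :
    (factorAt x i n)[t] = x (i + t) := by
  simp [factorAt_def]

theorem factorAt_getElem? (x : ℤ → A) (i : ℤ) (n t : ℕ) (h : t < n) :
    (factorAt x i n)[t]? = some (x (i + t)) := by
  simp [factorAt_def, h]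

theorem factorAt_eq_iff (x y : ℤ → A) (i j : ℤ) (n : ℕ) :
    factorAt x i n = factorAt y j n ↔ ∀ t : ℕ, t < n → x (i + t) = y (j + t) := by
  simp [factorAt_def]

theorem factorAt_add (x : ℤ → A) (i : ℤ) (m n : ℕ) :
    factorAt x i (m + n) = factorAt x i m ++ factorAt x (i + m) n := by
  simp [factorAt_def, List.range_add, Function.comp_def, add_assoc]

theorem factorAt_append {x : ℤ → A} {i : ℤ} {n : ℕ} {a b : List A}
    (h : factorAt x i n = a ++ b) :
    n = a.length + b.length ∧ a = factorAt x i a.length ∧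
      b = factorAt x (i + a.length) b.length := by
  have hl : n = a.length + b.length := by
    have := congrArg List.length h
    simpa [factorAt_length] using this
  refine ⟨hl, ?_⟩
  rw [hl, factorAt_add] at h
  have := List.append_inj h (by simp [factorAt_length])
  exact ⟨this.1.symm, this.2.symm⟩

theorem factorAt_infix {x : ℤ → A} {i : ℤ} {n : ℕ} {w : List A}
    (h : w <:+: factorAt x i n) :
    ∃ k : ℕ, k + w.length ≤ n ∧ w = factorAt x (i + k) w.length := by
  obtain ⟨a, b, hab⟩ := h
  obtain ⟨h1, h2, -⟩ := factorAt_append hab.symm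
  obtain ⟨h3, -, h5⟩ := factorAt_append h2.symm
  refine ⟨a.length, ?_, h5⟩
  simp at h1
  omega

theorem factorAt_isInfix (x : ℤ → A) (i : ℤ) (n k m : ℕ) (h : k + m ≤ n) :
    factorAt x (i + k) m <:+: factorAt x i n := by
  obtain ⟨r, rfl⟩ := Nat.exists_eq_add_of_le h
  refine ⟨factorAt x i k, factorAt x (i + (k + m : ℕ)) r, ?_⟩
  rw [factorAt_add, factorAt_add]

theorem factorAt_flatMap {f : B → List A} {x : ℤ → A} {y : ℤ → B} {c : ℤ} {q : ℕ} 
    (h : ∀ j, f (y j) = factorAt x (c + j * q) q) (i : ℤ) (n : ℕ) :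
    (factorAt y i n).flatMap f = factorAt x (c + i * q) (n * q) := by
  induction n with
  | zero => simp [factorAt_def]
  | succ n ih =>
    rw [factorAt_add, List.flatMap_append, ih, Nat.succ_mul, factorAt_add]
    congr 1
    simp only [factorAt_def, List.range_one, List.map_cons, List.map_nil, List.flatMap_cons,
      List.flatMap_nil, List.append_nil]
    have := h (i + n)
    simp only [factorAt_def] at this
    simp only [Nat.cast_zero, add_zero, this]
    push_cast
    congr 1
    funext t
    congr 1
    ring

/-! ### pigeonhole -/

theorem pigeon {ι : Type*} [Finite ι] (P : ℕ → ι → Prop)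
    (anti : ∀ s s' i, s ≤ s' → P s' i → P s i) (h : ∀ s, ∃ i, P s i) : ∃ i, ∀ s, P s i := by
  by_contra hc
  push Not at hc
  choose f hf using hc
  have := Fintype.ofFinite ι
  obtain ⟨i, hi⟩ := h (Finset.univ.sup f)
  exact hf i (anti _ _ i (Finset.le_sup (Finset.mem_univ i)) hi)

/-! ### Toeplitz windows -/

theorem toeplitz_window {x : ℤ → A} (hx : IsToeplitz x) (i : ℤ) (n : ℕ) :
    ∃ M : ℕ, 0 < M ∧ ∀ t : ℕ, t < n → ∀ k : ℤ, x (i + t + k * M) = x (i + t) := by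
  induction n with
  | zero => exact ⟨1, one_pos, by simp⟩
  | succ n ih =>
    obtain ⟨M, hM, h⟩ := ih
    obtain ⟨p, hp, h'⟩ := hx (i + n)
    refine ⟨M * p, by positivity, fun t ht k => ?_⟩
    rcases Nat.lt_succ_iff_lt_or_eq.1 ht with h1 | rfl
    · have := h t h1 (k * p)
      rw [← this]; push_cast; congr 1; ring
    · have := h' (k * M)
      rw [← this]; push_cast; congr 1; ring

/-! ### Two phases -/

theorem per_int {x : ℤ → A} (hx : IsAperiodicPoint x) (p : ℤ) (hp : 0 < p) :
    ∃ i, x (i + p) ≠ x i := by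
  by_contra h
  push Not at h
  apply hx
  refine ⟨p.toNat, by omega, fun i => ?_⟩
  rw [Int.toNat_of_nonneg hp.le]
  exact h i

theorem per_mul {x : ℤ → A} {p : ℤ} (h : ∀ i, x (i + p) = x i) (k i : ℤ) :
    x (i + k * p) = x i := by
  induction k with
  | zero => simp
  | succ k ih =>
    rw [← ih, ← h (i + k * p)]; congr 1; ring
  | pred k ih =>
    rw [← ih, ← h (i + (-k - 1) * p)]; congr 1; ring

theorem blk {q : ℤ} (hq : 0 < q) (c p : ℤ) : ∃ j t : ℤ, 0 ≤ t ∧ t < q ∧ p = c + j * q + t := by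
  refine ⟨(p - c) / q, (p - c) % q, Int.emod_nonneg _ hq.ne', Int.emod_lt_of_pos _ hq, ?_⟩
  have := Int.mul_ediv_add_emod (p - c) q
  linarith

theorem y_nonconst {x : ℤ → C} (hx : IsAperiodicPoint x) (W : B → ℤ → C) (q : ℤ) (hq : 0 < q)
    (y : ℤ → B) (c : ℤ) (h : ∀ j t : ℤ, 0 ≤ t → t < q → x (c + j * q + t) = W (y j) t)
    (l : ℤ) (hl : 0 < l) : ∃ j, y (j + l) ≠ y j := by
  by_contra hc
  push Not at hc
  obtain ⟨i, hi⟩ := per_int hx (l * q) (by positivity)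
  obtain ⟨j, t, h0, h1, rfl⟩ := blk hq c i
  apply hi
  rw [h j t h0 h1, ← hc j, ← h (j + l) t h0 h1]
  congr 1; ring

theorem nonconst_iff {x : ℤ → C} (hx : IsAperiodicPoint x)
    (hB : ∀ a b c : B, a = b ∨ b = c ∨ a = c) (W : B → ℤ → C) (q : ℤ) (hq : 0 < q)
    (y : ℤ → B) (c : ℤ) (h : ∀ j t : ℤ, 0 ≤ t → t < q → x (c + j * q + t) = W (y j) t)
    (t : ℤ) (h0 : 0 ≤ t) (h1 : t < q) :
    (∃ a b, W a t ≠ W b t) ↔ ∃ j : ℤ, x (c + t + j * q) ≠ x (c + t) := by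
  have e : ∀ j, x (c + t + j * q) = W (y j) t := fun j => by
    rw [← h j t h0 h1]; congr 1; ring
  have e0 : x (c + t) = W (y 0) t := by rw [← e 0]; simp
  constructor
  · rintro ⟨a, b, hab⟩
    by_contra hc
    push Not at hc
    obtain ⟨j, hj⟩ := y_nonconst hx W q hq y c h 1 one_pos
    have hj' : W (y (j+1)) t = W (y j) t := by
      rw [← e, ← e, hc, hc]
    rcases hB a (y (j+1)) (y j) with h1 | h1 | h1
    · rcases hB b (y (j+1)) (y j) with h2 | h2 | h2
      · exact hab (by rw [h1, h2])
      · exact hj h2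
      · exact hab (by rw [h1, h2, hj'])
    · exact hj h1
    · rcases hB b (y (j+1)) (y j) with h2 | h2 | h2
      · exact hab (by rw [h1, h2, hj'])
      · exact hj h2
      · exact hab (by rw [h1, h2])
  · rintro ⟨j, hj⟩
    rw [e, e0] at hj
    exact ⟨_, _, hj⟩

theorem two_phase {x : ℤ → C} (hx : IsAperiodicPoint x)
    (hB : ∀ a b c : B, a = b ∨ b = c ∨ a = c) (W : B → ℤ → C) (q : ℤ)
    (y y' : ℤ → B) (c d : ℤ) (hd : 0 < d) (hdq : d < q)
    (h : ∀ j t : ℤ, 0 ≤ t → t < q → x (c + j * q + t) = W (y j) t)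
    (h' : ∀ j t : ℤ, 0 ≤ t → t < q → x (c + d + j * q + t) = W (y' j) t) : False := by
  have hq : 0 < q := hd.trans hdq
  set N : ℤ → Prop := fun p => ∃ j : ℤ, x (p + j * q) ≠ x p with hN
  have Nq : ∀ p, N p → N (p + q) := by
    rintro p ⟨j, hj⟩
    by_contra hc
    simp only [hN, not_exists, not_not] at hc
    apply hj
    have a := hc (j - 1)
    have b := hc (-1)
    rw [show p + q + (j - 1) * q = p + j * q by ring] at a
    rw [show p + q + (-1) * q = p by ring] at b
    rw [a, b]
  have Nq' : ∀ p, N p → N (p - q) := by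
    rintro p ⟨j, hj⟩
    by_contra hc
    simp only [hN, not_exists, not_not] at hc
    apply hj
    have a := hc (j + 1)
    have b := hc 1
    rw [show p - q + (j + 1) * q = p + j * q by ring] at a
    rw [show p - q + 1 * q = p by ring] at b
    rw [a, b]
  have mulN : ∀ e : ℤ, (∀ p, N p → N (p + e)) → (∀ p, N p → N (p - e)) →
      ∀ k p : ℤ, N p → N (p + k * e) := by
    intro e h1 h2 k
    induction k with
    | zero => intro p hp; simpa using hp
    | succ k ih =>
      intro p hp
      have := h1 _ (ih p hp)
      convert this using 1; ring
    | pred k ih =>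
      intro p hp
      have := h2 _ (ih p hp)
      convert this using 1; ring
  have NW : ∀ t, 0 ≤ t → t < q → ((∃ a b, W a t ≠ W b t) ↔ N (c + t)) := fun t h0 h1 =>
    nonconst_iff hx hB W q hq y c h t h0 h1
  have NW' : ∀ t, 0 ≤ t → t < q → ((∃ a b, W a t ≠ W b t) ↔ N (c + d + t)) := fun t h0 h1 =>
    nonconst_iff hx hB W q hq y' (c + d) h' t h0 h1
  have Nd : ∀ p, N p → N (p + d) := by
    intro p hp
    obtain ⟨j, t, h0, h1, rfl⟩ := blk hq c p
    have h2 : N (c + t) := by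
      have := mulN q Nq Nq' (-j) _ hp
      convert this using 1; ring
    have h3 := (NW' t h0 h1).1 ((NW t h0 h1).2 h2)
    have := mulN q Nq Nq' j _ h3
    convert this using 1; ring
  have Nd' : ∀ p, N p → N (p - d) := by
    intro p hp
    obtain ⟨j, t, h0, h1, rfl⟩ := blk hq (c + d) p
    have h2 : N (c + d + t) := by
      have := mulN q Nq Nq' (-j) _ hp
      convert this using 1; ring
    have h3 := (NW t h0 h1).1 ((NW' t h0 h1).2 h2)
    have := mulN q Nq Nq' j _ h3
    convert this using 1; ring
  obtain ⟨p, hp⟩ : ∃ p, N p := by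
    obtain ⟨i, hi⟩ := per_int hx q hq
    exact ⟨i, 1, by simpa using hi⟩
  -- a nonconstant class in `[0, d)`
  obtain ⟨t0, ht0, ht0d, Nt0⟩ : ∃ t, 0 ≤ t ∧ t < d ∧ N (c + t) := by
    obtain ⟨j, t, h0, h1, rfl⟩ := blk hd c p
    refine ⟨t, h0, h1, ?_⟩
    have := mulN d Nd Nd' (-j) _ hp
    convert this using 1; ring
  obtain ⟨t1, ht1, ht1q, Nt1⟩ : ∃ t, d ≤ t ∧ t < q ∧ N (c + t) := by
    obtain ⟨j, t, h0, h1, rfl⟩ := blk (sub_pos.2 hdq) (c + d) p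
    refine ⟨t + d, by omega, by omega, ?_⟩
    have := mulN (q - d) (fun p hp => by have := Nq _ (Nd' p hp); convert this using 1; ring)
      (fun p hp => by have := Nq' _ (Nd p hp); convert this using 1; ring) (-j) _ hp
    convert this using 1; ring
  have inj : ∀ t, 0 ≤ t → t < q → N (c + t) → ∀ a b, W a t = W b t → a = b := by
    intro t h0 h1 hn a b hab
    obtain ⟨e, f, hef⟩ := (NW t h0 h1).2 hn
    by_contra hne
    rcases hB a b e with h2 | rfl | rfl
    · exact hne h2
    · rcases hB a b f with h3 | rfl | rfl
      · exact hne h3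
      · exact hef rfl
      · exact hef hab.symm
    · rcases hB a b f with h3 | rfl | rfl
      · exact hne h3
      · exact hef hab
      · exact hef rfl
  have r1 : ∀ i j, y i = y j ↔ y' i = y' j := by
    intro i j
    have e : ∀ j, W (y j) t1 = W (y' j) (t1 - d) := fun j => by
      rw [← h j t1 (by omega) ht1q, ← h' j (t1 - d) (by omega) (by omega)]
      congr 1; ring
    have n2 : N (c + (t1 - d)) := by have := Nd' _ Nt1; convert this using 1; ring
    constructor
    · intro hh
      exact inj (t1 - d) (by omega) (by omega) n2 _ _ (by rw [← e, ← e, hh])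
    · intro hh
      exact inj t1 (by omega) (by omega) Nt1 _ _ (by rw [e, e, hh])
  have r2 : ∀ i j, y i = y j ↔ y' (i - 1) = y' (j - 1) := by
    intro i j
    have e : ∀ j, W (y j) t0 = W (y' (j - 1)) (t0 + q - d) := fun j => by
      rw [← h j t0 (by omega) (by omega), ← h' (j - 1) (t0 + q - d) (by omega) (by omega)]
      congr 1; ring
    have n2 : N (c + (t0 + q - d)) := by have := Nq _ (Nd' _ Nt0); convert this using 1; ring
    constructor
    · intro hh
      exact inj (t0 + q - d) (by omega) (by omega) n2 _ _ (by rw [← e, ← e, hh])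
    · intro hh
      exact inj t0 (by omega) (by omega) Nt0 _ _ (by rw [e, e, hh])
  obtain ⟨j, hj⟩ := y_nonconst hx W q hq y' (c + d) h' 2 two_pos
  have k1 : y' j = y' (j + 1) ↔ y' (j + 1) = y' (j + 2) := by
    have := (r2 (j + 1) (j + 2)).symm.trans (r1 (j + 1) (j + 2))
    rw [show j + 1 - 1 = j by ring, show j + 2 - 1 = j + 1 by ring] at this
    exact this
  rcases hB (y' j) (y' (j + 1)) (y' (j + 2)) with h3 | h3 | h3
  · exact hj (h3.trans (k1.1 h3)).symm
  · exact hj ((k1.2 h3).trans h3).symm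
  · exact hj h3.symm

/-- Two phases of an aperiodic point agree modulo `q`. -/
theorem two_phase_dvd {x : ℤ → C} (hx : IsAperiodicPoint x)
    (hB : ∀ a b c : B, a = b ∨ b = c ∨ a = c) (W : B → ℤ → C) (q : ℤ) (hq : 0 < q)
    (y y' : ℤ → B) (c c' : ℤ)
    (h : ∀ j t : ℤ, 0 ≤ t → t < q → x (c + j * q + t) = W (y j) t)
    (h' : ∀ j t : ℤ, 0 ≤ t → t < q → x (c' + j * q + t) = W (y' j) t) : q ∣ c' - c := by
  obtain ⟨j, t, h0, h1, e⟩ := blk hq 0 (c' - c)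
  by_contra hnd
  have ht : 0 < t := by
    rcases h0.lt_or_eq with h2 | h2
    · exact h2
    · exact absurd ⟨j, by rw [e, ← h2]; ring⟩ hnd
  refine two_phase hx hB W q y (fun i => y' (i - j)) c t ht h1 h ?_
  intro i s hs hsq
  rw [← h' (i - j) s hs hsq]
  congr 1
  have : c' = c + j * q + t := by linarith
  rw [this]; ring

/-! ### The orbit closure -/

theorem mem_closure_orbit [TopologicalSpace A] [DiscreteTopology A] (x z : ℤ → A) :
    z ∈ closure (orbit x) ↔ ∀ (i : ℤ) (m : ℕ), ∃ i' : ℤ, factorAt z i m = factorAt x i' m := by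
  constructor
  · intro h i m
    have ho : IsOpen {w : ℤ → A | ∀ t ∈ Finset.range m, w (i + (t : ℕ)) = z (i + (t : ℕ))} := by
      have e : {w : ℤ → A | ∀ t ∈ Finset.range m, w (i + (t : ℕ)) = z (i + (t : ℕ))}
          = ⋂ t ∈ Finset.range m, {w : ℤ → A | w (i + ((t : ℕ) : ℤ)) = z (i + ((t : ℕ) : ℤ))} := by
        ext w; simp
      rw [e]
      refine isOpen_biInter_finset (fun t _ => ?_)
      have hc : Continuous (fun w : ℤ → A => w (i + (t : ℤ))) := continuous_apply _
      exact (isOpen_discrete ({z (i + (t : ℤ))} : Set A)).preimage hc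
    obtain ⟨w, hw, k, rfl⟩ := mem_closure_iff.1 h _ ho (by simp)
    refine ⟨i + k, ?_⟩
    rw [factorAt_eq_iff]
    intro t ht
    have := hw t (Finset.mem_range.2 ht)
    rw [← this, shiftBy]
    congr 1; ring
  · intro h
    rw [mem_closure_iff_nhds]
    intro s hs
    rw [nhds_pi, Filter.mem_pi] at hs
    obtain ⟨I, hI, t, ht, hts⟩ := hs
    obtain ⟨N, hN⟩ : ∃ N : ℕ, ∀ i ∈ I, -(N : ℤ) ≤ i ∧ i < N := by
      obtain ⟨b, hb⟩ := (hI.image (fun i : ℤ => i.natAbs)).bddAbove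
      refine ⟨b + 1, fun i hi => ?_⟩
      have : i.natAbs ≤ b := hb (Set.mem_image_of_mem _ hi)
      omega
    obtain ⟨i', hi'⟩ := h (-(N : ℤ)) (2 * N)
    rw [factorAt_eq_iff] at hi'
    refine ⟨shiftBy (i' + N) x, hts ?_, _, rfl⟩
    intro i hi
    have := hN i hi
    have e := hi' (i + N).toNat (by omega)
    rw [Int.toNat_of_nonneg (by omega)] at e
    have e2 : shiftBy (i' + N) x i = z i := by
      rw [shiftBy, show z i = z (-(N : ℤ) + (i + N)) by congr 1; ring, e]
      congr 1; ring
    rw [e2]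
    exact mem_of_mem_nhds (ht i)

theorem mem_Lang [TopologicalSpace A] [DiscreteTopology A] (x : ℤ → A) (n : ℕ) (w : List A) :
    w ∈ Lang n (closure (orbit x)) ↔ ∃ i, w = factorAt x i n := by
  constructor
  · rintro ⟨z, hz, i, rfl⟩
    obtain ⟨i', h⟩ := (mem_closure_orbit x z).1 hz i n
    exact ⟨i', h⟩
  · rintro ⟨i, rfl⟩
    exact ⟨x, subset_closure ⟨0, by funext i; simp [shiftBy]⟩, i, rfl⟩

/-! ### Phases -/

/-- The window `[i, i+n)` of `x` can be cut into `u`, `v` at phase `c`. -/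
def Ph (x : ℤ → A) (q : ℕ) (u v : List A) (c i : ℤ) (n : ℕ) : Prop :=
  ∀ j : ℤ, ∃ w, (w = u ∨ w = v) ∧ ∀ t : ℕ, t < q → i ≤ c + j * q + t → c + j * q + t < i + n →
    w[t]? = some (x (c + j * q + t))

/-- The whole of `x` can be cut into `u`, `v` at phase `c`. -/
def GPh (x : ℤ → A) (q : ℕ) (u v : List A) (c : ℤ) : Prop :=
  ∀ j : ℤ, ∃ w, (w = u ∨ w = v) ∧ ∀ t : ℕ, t < q → w[t]? = some (x (c + j * q + t))

theorem GPh.ph {x : ℤ → A} {q : ℕ} {u v : List A} {c : ℤ} (h : GPh x q u v c) (i : ℤ) (n : ℕ) :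
    Ph x q u v c i n := by
  intro j
  obtain ⟨w, hw, h2⟩ := h j
  exact ⟨w, hw, fun t ht _ _ => h2 t ht⟩

theorem Ph.mono {x : ℤ → A} {q : ℕ} {u v : List A} {c i i' : ℤ} {n n' : ℕ}
    (h : Ph x q u v c i n) (h1 : i ≤ i') (h2 : i' + n' ≤ i + n) : Ph x q u v c i' n' := by
  intro j
  obtain ⟨w, hw, h3⟩ := h j
  exact ⟨w, hw, fun t ht a b => h3 t ht (by omega) (by omega)⟩

theorem Ph.add {x : ℤ → A} {q : ℕ} {u v : List A} {c i : ℤ} {n : ℕ}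
    (h : Ph x q u v c i n) (k : ℤ) : Ph x q u v (c + k * q) i n := by
  intro j
  obtain ⟨w, hw, h3⟩ := h (k + j)
  refine ⟨w, hw, fun t ht a b => ?_⟩
  have e : c + k * q + j * q + t = c + (k + j) * q + t := by ring
  rw [e] at a b ⊢
  exact h3 t ht a b

theorem Ph.congr {x : ℤ → A} {q : ℕ} {u v : List A} {c c' i : ℤ} {n : ℕ}
    (h : Ph x q u v c i n) (hc : (q : ℤ) ∣ c' - c) : Ph x q u v c' i n := by
  obtain ⟨k, hk⟩ := hc
  have := h.add k
  rwa [show c + k * q = c' by linarith] at this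

/-- Translating a window. -/
theorem Ph.translate {x : ℤ → A} {q : ℕ} {u v : List A} {c i l : ℤ} {n : ℕ}
    (h : Ph x q u v c (i + l) n) (hl : ∀ p, i ≤ p → p < i + n → x (p + l) = x p) :
    Ph x q u v (c - l) i n := by
  intro j
  obtain ⟨w, hw, h3⟩ := h j
  refine ⟨w, hw, fun t ht a b => ?_⟩
  rw [h3 t ht (by linarith) (by linarith), ← hl _ a b]
  congr 2; ring

theorem GPh.of_ph {x : ℤ → A} {q : ℕ} {u v : List A} {c : ℤ}
    (h : ∀ s : ℕ, Ph x q u v c (-(s : ℤ)) (2 * s)) : GPh x q u v c := by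
  intro j
  have hb : ∃ s : ℕ, -(s : ℤ) ≤ c + j * q ∧ c + j * q + q < s :=
    ⟨(c + j * q).natAbs + q + 1, by omega, by omega⟩
  obtain ⟨s, hs, hs'⟩ := hb
  obtain ⟨w, hw, h3⟩ := h s j
  exact ⟨w, hw, fun t ht => h3 t ht (by omega) (by push_cast; omega)⟩

theorem GPh.unique {x : ℤ → A} (hx : IsAperiodicPoint x) {q : ℕ} (hq : 0 < q) {u v : List A}
    {c c' : ℤ} (h : GPh x q u v c) (h' : GPh x q u v c') : (q : ℤ) ∣ c' - c := by
  have key : ∀ c, GPh x q u v c → ∃ y : ℤ → {w : List A // w = u ∨ w = v}, 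
      ∀ j t : ℤ, 0 ≤ t → t < q →
        some (x (c + j * q + t)) = (y j).1[t.toNat]? := by
    intro c h
    choose f hf hf' using h
    refine ⟨fun j => ⟨f j, hf j⟩, fun j t h0 h1 => ?_⟩
    have := hf' j t.toNat (by omega)
    rw [Int.toNat_of_nonneg h0] at this
    exact this.symm
  obtain ⟨y, hy⟩ := key c h
  obtain ⟨y', hy'⟩ := key c' h'
  have hap : IsAperiodicPoint (fun i => some (x i)) := by
    rintro ⟨p, hp, h⟩
    exact hx ⟨p, hp, fun i => Option.some.inj (h i)⟩
  refine two_phase_dvd hap ?_ (fun w t => w.1[t.toNat]?) (q : ℤ) (by exact_mod_cast hq) y y' c c' hy hy'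
  rintro ⟨a, rfl | rfl⟩ ⟨b, rfl | rfl⟩ ⟨c, rfl | rfl⟩ <;> simp

/-- Long windows of an aperiodic Toeplitz sequence determine the phase. -/
theorem unique_window {x : ℤ → A} (hx : IsAperiodicPoint x) (hT : IsToeplitz x)
    {q : ℕ} (hq : 0 < q) {u v : List A} {c : ℤ} (h : GPh x q u v c) :
    ∃ N : ℕ, ∀ (i : ℤ) (n : ℕ), N ≤ n → ∀ c', Ph x q u v c' i n → (q : ℤ) ∣ c' - c := by
  by_contra hc
  push Not at hc
  have hq' : (0 : ℤ) < q := by exact_mod_cast hq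
  have key : ∃ ab : Fin q × Fin q, ∀ s : ℕ, ab.1 ≠ ab.2 ∧
      Ph x q u v ab.1 (-(s : ℤ)) (2 * s) ∧ Ph x q u v ab.2 (-(s : ℤ)) (2 * s) := by
    apply pigeon
    · rintro s s' ab hs ⟨h1, h2, h3⟩
      exact ⟨h1, h2.mono (by omega) (by push_cast; omega), h3.mono (by omega) (by push_cast; omega)⟩
    · intro s
      obtain ⟨M, hM, hM'⟩ := toeplitz_window hT (-(s : ℤ)) (2 * s)
      obtain ⟨i, n, hn, c', hc', hnd⟩ := hc (M + 2 * s)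
      obtain ⟨l, t, h0, h1, e⟩ := blk (q := M) (by exact_mod_cast hM) (-(s : ℤ)) (i + M)
      have hper : ∀ p, -(s : ℤ) ≤ p → p < -(s : ℤ) + (2 * s : ℕ) → x (p + l * M) = x p := by
        intro p hp hp'
        have := hM' (p + s).toNat (by omega) l
        rw [Int.toNat_of_nonneg (by omega)] at this
        rw [show -(s : ℤ) + (p + s) = p by ring] at this
        exact this
      have p1 := (hc'.mono (i' := -(s : ℤ) + l * M) (n' := 2 * s) (by linarith)
        (by push_cast; have : ((M + 2 * s : ℕ) : ℤ) ≤ n := by exact_mod_cast hn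
            push_cast at this; linarith)).translate hper
      have p2 := (h.ph (-(s : ℤ) + l * M) (2 * s)).translate hper
      have red : ∀ a : ℤ, ∃ b : Fin q, (q : ℤ) ∣ ((b : ℕ) : ℤ) - a := by
        intro a
        obtain ⟨j, t, h0, h1, e⟩ := blk hq' 0 a
        refine ⟨⟨t.toNat, by omega⟩, -j, ?_⟩
        simp only [Int.toNat_of_nonneg h0]
        rw [e]; ring
      obtain ⟨a, ha⟩ := red (c' - l * M)
      obtain ⟨b, hb⟩ := red (c - l * M)
      refine ⟨(a, b), ?_, p1.congr ha, p2.congr hb⟩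
      rintro hab
      simp only at hab
      subst hab
      apply hnd
      have := dvd_sub hb ha
      rwa [show ((a : ℕ) : ℤ) - (c - l * M) - ((a : ℕ) - (c' - l * M)) = c' - c by ring] at this
  obtain ⟨⟨a, b⟩, hab⟩ := key
  have ha := GPh.of_ph fun s => (hab s).2.1
  have hb := GPh.of_ph fun s => (hab s).2.2
  have := GPh.unique hx hq ha hb
  apply (hab 0).1
  simp only at this ⊢
  have h1 := a.2
  have h2 := b.2
  ext
  have := Int.eq_zero_of_abs_lt_dvd this (by rw [abs_lt]; constructor <;> omega)
  omega

/-! ### Buildings -/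

/-- The candidate building with `|β₀| = k`. -/
def canon (x : ℤ → A) (q : ℕ) (i : ℤ) (n k : ℕ) : List A × List (List A) × List A :=
  (factorAt x i k, (List.range ((n - k) / q)).map (fun j : ℕ => factorAt x (i + k + j * q) q),
    factorAt x (i + k + ((n - k) / q : ℕ) * q) ((n - k) % q))

theorem flatten_range (x : ℤ → A) (q : ℕ) (i : ℤ) (m : ℕ) :
    ((List.range m).map (fun j : ℕ => factorAt x (i + j * q) q)).flatten
      = factorAt x i (m * q) := by
  induction m with
  | zero => simp [factorAt_def]
  | succ m ih =>
    rw [List.range_succ, List.map_append, List.flatten_append, ih, Nat.succ_mul, factorAt_add]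
    simp

theorem flatten_cut {x : ℤ → A} {q : ℕ} {i : ℤ} {m : ℕ} {l : List (List A)}
    (h : factorAt x i m = l.flatten) (hl : ∀ a ∈ l, a.length = q) :
    m = l.length * q ∧ l = (List.range l.length).map (fun j : ℕ => factorAt x (i + j * q) q) := by
  induction l generalizing i m with
  | nil =>
    have := congrArg List.length h
    simp [factorAt_length] at this
    simp [this]
  | cons a l ih =>
    rw [List.flatten_cons] at h
    obtain ⟨h1, h2, h3⟩ := factorAt_append h
    have ha : a.length = q := hl a (by simp)
    rw [ha] at h1 h2 h3
    obtain ⟨h4, h5⟩ := ih h3.symm (fun b hb => hl b (by simp [hb]))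
    constructor
    · rw [h1, h4]; simp; ring
    · rw [List.length_cons, List.range_succ_eq_map, List.map_cons, List.map_map]
      simp only [Nat.cast_zero, zero_mul, add_zero]
      rw [← h2]
      congr 1
      conv_lhs => rw [h5]
      apply List.map_congr_left
      intro j _
      simp only [Function.comp, Nat.succ_eq_add_one]
      congr 1; push_cast; ring

theorem IsBuilding.eq_canon {x : ℤ → A} {q : ℕ} {u v : List A} (hu : u.length = q)
    (hv : v.length = q) {i : ℤ} {n : ℕ} {b : List A × List (List A) × List A}
    (h : IsBuilding {u, v} (factorAt x i n) b) :
    b.1.length < q ∧ b.1.length ≤ n ∧ b = canon x q i n b.1.length := by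
  obtain ⟨b0, l, b1⟩ := b
  obtain ⟨h1, h2, ⟨w, hw, hs, hne⟩, ⟨w', hw', hs', hne'⟩⟩ := h
  simp only at *
  have L : ∀ w ∈ ({u, v} : Set (List A)), w.length = q := by
    rintro w (rfl | rfl) <;> assumption
  have k0 : b0.length < q := by
    rw [← L w hw]
    exact lt_of_le_of_ne hs.length_le fun e => hne (hs.eq_of_length e)
  have k1 : b1.length < q := by
    rw [← L w' hw']
    exact lt_of_le_of_ne hs'.length_le fun e => hne' (hs'.eq_of_length e)
  obtain ⟨a1, a2, a3⟩ := factorAt_append h1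
  obtain ⟨a4, a5, a6⟩ := factorAt_append a2.symm
  obtain ⟨a7, a8⟩ := flatten_cut a6.symm (fun a ha => L a (h2 a ha))
  have hn : n - b0.length = b1.length + q * l.length := by
    rw [a1, a4, a7, mul_comm q]; omega
  have hd : (n - b0.length) / q = l.length := by
    rw [hn, Nat.add_mul_div_left _ _ (by omega), Nat.div_eq_of_lt k1, zero_add]
  have hm : (n - b0.length) % q = b1.length := by
    rw [hn, Nat.add_mul_mod_self_left, Nat.mod_eq_of_lt k1]
  refine ⟨k0, by omega, ?_⟩
  simp only [canon, hd, hm, Prod.mk.injEq]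
  refine ⟨a5, a8, ?_⟩
  have e : (i + ((b0 ++ l.flatten).length : ℤ)) = i + b0.length + (l.length : ℕ) * q := by
    rw [List.length_append, a7]; push_cast; ring
  rw [e] at a3
  exact a3

theorem IsBuilding.ph {x : ℤ → A} {q : ℕ} {u v : List A} (hu : u.length = q)
    (hv : v.length = q) {i : ℤ} {n k : ℕ} (hk : k < q) (hkn : k ≤ n)
    (h : IsBuilding {u, v} (factorAt x i n) (canon x q i n k)) : Ph x q u v (i + k) i n := by
  have hq : 0 < q := by omega
  have hq' : (0 : ℤ) < q := by exact_mod_cast hq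
  have L : ∀ w ∈ ({u, v} : Set (List A)), w.length = q := by
    rintro w (rfl | rfl) <;> assumption
  obtain ⟨-, h2, ⟨w, hw, hs, -⟩, ⟨w', hw', hs', -⟩⟩ := h
  simp only [canon] at h2 hs hs'
  have hdm := Nat.div_add_mod (n - k) q
  set m := (n - k) / q with hm
  set e := (n - k) % q with he
  have he' : e < q := Nat.mod_lt _ hq
  have hn : (n : ℤ) = k + m * q + e := by
    have : n = k + (q * m + e) := by omega
    rw [this]; push_cast; ring
  intro j
  rcases lt_trichotomy j (-1) with hj | rfl | hj
  · refine ⟨u, Or.inl rfl, fun t ht a b => ?_⟩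
    exfalso
    have : j * q ≤ (-2) * q := by
      apply mul_le_mul_of_nonneg_right (by omega) hq'.le
    omega
  · refine ⟨w, by simpa using hw, fun t ht a b => ?_⟩
    obtain ⟨p, hp⟩ := hs
    have hpl : p.length = q - k := by
      have := congrArg List.length hp
      rw [List.length_append, factorAt_length, L w hw] at this
      omega
    rw [← hp, List.getElem?_append_right (by rw [hpl]; omega), hpl,
      factorAt_getElem? _ _ _ _ (by omega)]
    congr 2
    rw [Nat.cast_sub (by omega), Nat.cast_sub (by omega)]
    ring
  · obtain ⟨j, rfl⟩ := Int.eq_ofNat_of_zero_le (show 0 ≤ j by omega)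
    rcases lt_trichotomy j m with hjm | rfl | hjm
    · have := h2 (factorAt x (i + k + j * q) q)
        (List.mem_map.2 ⟨j, List.mem_range.2 hjm, rfl⟩)
      refine ⟨_, by simpa using this, fun t ht a b => ?_⟩
      rw [factorAt_getElem? _ _ _ _ ht]
    · refine ⟨w', by simpa using hw', fun t ht a b => ?_⟩
      obtain ⟨p, hp⟩ := hs'
      have hte : t < e := by omega
      rw [← hp, List.getElem?_append_left (by rw [factorAt_length]; exact hte),
        factorAt_getElem? _ _ _ _ hte]
    · refine ⟨u, Or.inl rfl, fun t ht a b => ?_⟩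
      exfalso
      have : ((m : ℤ) + 1) * q ≤ (j : ℤ) * q := by
        apply mul_le_mul_of_nonneg_right (by exact_mod_cast hjm) hq'.le
      rw [add_mul] at this
      omega

theorem Ph.isBuilding {x : ℤ → A} {q : ℕ} {u v : List A} (hu : u.length = q)
    (hv : v.length = q) {i : ℤ} {n k : ℕ} (hk : k < q) (hqn : q ≤ n)
    (h : Ph x q u v (i + k) i n) : IsBuilding {u, v} (factorAt x i n) (canon x q i n k) := by
  have hq : 0 < q := by omega
  have hq' : (0 : ℤ) < q := by exact_mod_cast hq
  have L : ∀ w, w = u ∨ w = v → w.length = q := by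
    rintro w (rfl | rfl) <;> assumption
  have hdm := Nat.div_add_mod (n - k) q
  unfold IsBuilding
  simp only [canon]
  set m := (n - k) / q with hm
  set e := (n - k) % q with he
  have he' : e < q := Nat.mod_lt _ hq
  have hn1 : n = k + m * q + e := by rw [mul_comm]; omega
  have hn : (n : ℤ) = k + m * q + e := by exact_mod_cast hn1
  refine ⟨?_, ?_, ?_, ?_⟩
  · rw [flatten_range, ← factorAt_add]
    conv_lhs => rw [hn1, factorAt_add]
    congr 2
    push_cast; ring
  · intro a ha
    obtain ⟨j, hj, rfl⟩ := List.mem_map.1 ha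
    rw [List.mem_range] at hj
    obtain ⟨w, hw, h3⟩ := h j
    have : ((j : ℤ) + 1) * q ≤ m * q := by
      apply mul_le_mul_of_nonneg_right (by exact_mod_cast hj) hq'.le
    rw [add_mul] at this
    have h0 : 0 ≤ (j : ℤ) * q := by positivity
    have : factorAt x (i + k + j * q) q = w := by
      apply List.ext_getElem?
      intro t
      by_cases ht : t < q
      · rw [factorAt_getElem? _ _ _ _ ht, h3 t ht (by omega) (by omega)]
      · rw [List.getElem?_eq_none (by rw [factorAt_length]; omega),
          List.getElem?_eq_none (by rw [L w hw]; omega)]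
    rw [this]
    simpa using hw
  · obtain ⟨w, hw, h3⟩ := h (-1)
    have hs : factorAt x i k = w.drop (q - k) := by
      apply List.ext_getElem?
      intro t
      rw [List.getElem?_drop]
      by_cases ht : t < k
      · have e1 : (i + k + (-1) * q + ((q - k + t : ℕ) : ℤ)) = i + t := by
          rw [Nat.cast_add, Nat.cast_sub hk.le]; ring
        rw [factorAt_getElem? _ _ _ _ ht, h3 (q - k + t) (by omega) (by rw [e1]; omega)
          (by rw [e1]; omega), e1]
      · rw [List.getElem?_eq_none (by rw [factorAt_length]; omega),
          List.getElem?_eq_none (by rw [L w hw]; omega)]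
    refine ⟨w, by simpa using hw, hs ▸ List.drop_suffix _ _, fun e => ?_⟩
    have := congrArg List.length e
    rw [factorAt_length, L w hw] at this
    omega
  · obtain ⟨w, hw, h3⟩ := h m
    have h0 : 0 ≤ (m : ℤ) * q := by positivity
    have hs : factorAt x (i + k + m * q) e = w.take e := by
      apply List.ext_getElem?
      intro t
      by_cases ht : t < e
      · rw [factorAt_getElem? _ _ _ _ ht, List.getElem?_take_of_lt ht,
          h3 t (by omega) (by omega) (by omega)]
      · rw [List.getElem?_eq_none (by rw [factorAt_length]; omega),
          List.getElem?_eq_none (by rw [List.length_take]; omega)]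
    refine ⟨w, by simpa using hw, hs ▸ List.take_prefix _ _, fun e => ?_⟩
    have := congrArg List.length e
    rw [factorAt_length, L w hw] at this
    omega

theorem canon_inj {x : ℤ → A} {q : ℕ} {i : ℤ} {n k k' : ℕ}
    (h : canon x q i n k = canon x q i n k') : k = k' := by
  have := congrArg (fun b => b.1.length) h
  simpa [canon, factorAt_length] using this

/-- Unique buildings in terms of phases. -/
theorem uniquelyBuilt_iff {x : ℤ → A} {q : ℕ} {u v : List A} (hu : u.length = q)
    (hv : v.length = q) {i : ℤ} {n : ℕ} (hqn : q ≤ n) :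
    UniquelyBuiltFrom {u, v} (factorAt x i n) ↔
      ∃! k : ℕ, k < q ∧ Ph x q u v (i + k) i n := by
  constructor
  · rintro ⟨b, hb, hun⟩
    obtain ⟨h1, h2, h3⟩ := hb.eq_canon hu hv
    refine ⟨b.1.length, ⟨h1, IsBuilding.ph hu hv h1 h2 (h3 ▸ hb)⟩, ?_⟩
    rintro k ⟨hk, hp⟩
    have := hun _ (hp.isBuilding hu hv hk hqn)
    rw [h3] at this
    exact canon_inj this
  · rintro ⟨k, ⟨hk, hp⟩, hun⟩
    refine ⟨canon x q i n k, hp.isBuilding hu hv hk hqn, ?_⟩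
    intro b hb
    obtain ⟨h1, h2, h3⟩ := hb.eq_canon hu hv
    have := hun _ ⟨h1, IsBuilding.ph hu hv h1 h2 (h3 ▸ hb)⟩
    rw [h3, this]

/-! ### Towers -/

theorem aperiodic_of_factors {x z : ℤ → A}
    (hrec : ∀ (i : ℤ) (m : ℕ), ∃ M : ℕ, 0 < M ∧ ∀ t : ℕ, t < m → ∀ k : ℤ,
      x (i + t + k * M) = x (i + t))
    (hx : IsAperiodicPoint x)
    (hz : ∀ (i : ℤ) (m : ℕ), ∃ i' : ℤ, factorAt z i m = factorAt x i' m) :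
    IsAperiodicPoint z := by
  rintro ⟨P, hP, hper⟩
  apply hx
  refine ⟨P, hP, fun i => ?_⟩
  obtain ⟨M, hM, hM'⟩ := hrec i (P + 1)
  obtain ⟨i', hi'⟩ := hz 0 (M + P + 1)
  rw [factorAt_eq_iff] at hi'
  obtain ⟨l, t, h0, h1, e⟩ := blk (q := M) (by exact_mod_cast hM) i (i' + M)
  have e1 := hM' 0 (by omega) l
  have e2 := hM' P (by omega) l
  have f1 := hi' (M - t).toNat (by omega)
  have f2 := hi' ((M - t).toNat + P) (by omega)
  push_cast at f1 f2
  rw [Int.toNat_of_nonneg (by omega)] at f1 f2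
  rw [← add_assoc, hper, f1, ← add_assoc] at f2
  rw [show i' + (M - t) + P = i + P + l * M by linarith] at f2
  rw [show i' + (M - t) = i + (0 : ℕ) + l * M by push_cast; linarith] at f2
  rw [e1, e2] at f2
  simpa using f2.symm

section Tower

theorem tower_word (B : ℕ → Type) (y : ∀ n, ℤ → B n) (ℓ : ℕ → ℕ) (e : ℕ → ℤ)
    (hℓ : ∀ n, 2 ≤ ℓ n)
    (σ : ∀ n, B (n+1) → List (B n))
    (hσ : ∀ n j, σ n (y (n+1) j) = factorAt (y n) (e n + j * ℓ n) (ℓ n))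
    (n k : ℕ) : ∃ (E : ℤ) (L : ℕ), k < L ∧
    ∀ j, sadicWordAux σ n k (y (n + k) j) = factorAt (y n) (E + j * L) L := by
  induction k with
  | zero =>
    refine ⟨0, 1, one_pos, fun j => ?_⟩
    simp [sadicWordAux, factorAt_def]
  | succ k ih =>
    obtain ⟨E, L, hL, h⟩ := ih
    refine ⟨E + e (n + k) * L, ℓ (n + k) * L, ?_, fun j => ?_⟩
    · have := hℓ (n + k)
      nlinarith
    · show (σ (n + k) (y (n + k + 1) j)).flatMap _ = _
      rw [hσ, factorAt_flatMap h]
      congr 1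
      push_cast; ring

theorem tower_lang (B : ℕ → Type) (y : ∀ n, ℤ → B n) (ℓ : ℕ → ℕ) (e : ℕ → ℤ)
    (hℓ : ∀ n, 2 ≤ ℓ n)
    (σ : ∀ n, B (n+1) → List (B n))
    (hσ : ∀ n j, σ n (y (n+1) j) = factorAt (y n) (e n + j * ℓ n) (ℓ n))
    (hrec : ∀ n (i : ℤ) (m : ℕ), ∃ M : ℕ, 0 < M ∧ ∀ t : ℕ, t < m → ∀ k : ℤ,
      y n (i + t + k * M) = y n (i + t))
    (hs : ∀ n, Function.Surjective (y n))
    (n : ℕ) (i : ℤ) (m : ℕ) : ∃ K : ℕ, ∀ k, K ≤ k → ∀ a : B (n + k),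
    factorAt (y n) i m <:+: sadicWordAux σ n k a := by
  obtain ⟨M, hM, hM'⟩ := hrec n i m
  refine ⟨M + m, fun k hk a => ?_⟩
  obtain ⟨j, rfl⟩ := hs _ a
  obtain ⟨E, L, hL, h⟩ := tower_word B y ℓ e hℓ σ hσ n k
  rw [h]
  obtain ⟨l, t, h0, h1, e⟩ := blk (q := M) (by exact_mod_cast hM) i (E + j * L + M)
  have : factorAt (y n) i m = factorAt (y n) (E + j * L + ((M - t).toNat : ℕ)) m := by
    rw [factorAt_eq_iff]
    intro s hs
    rw [← hM' s hs l, Int.toNat_of_nonneg (by omega)]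
    congr 1
    linarith
  rw [this]
  apply factorAt_isInfix
  omega

theorem tower_XLevel (B : ℕ → Type) (y : ∀ n, ℤ → B n) (ℓ : ℕ → ℕ) (e : ℕ → ℤ)
    (hℓ : ∀ n, 2 ≤ ℓ n)
    (σ : ∀ n, B (n+1) → List (B n))
    (hσ : ∀ n j, σ n (y (n+1) j) = factorAt (y n) (e n + j * ℓ n) (ℓ n))
    (hrec : ∀ n (i : ℤ) (m : ℕ), ∃ M : ℕ, 0 < M ∧ ∀ t : ℕ, t < m → ∀ k : ℤ,
      y n (i + t + k * M) = y n (i + t))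
    (hs : ∀ n, Function.Surjective (y n))
    (n : ℕ) (z : ℤ → B n) : z ∈ XLevel σ n ↔
    ∀ (i : ℤ) (m : ℕ), ∃ i' : ℤ, factorAt z i m = factorAt (y n) i' m := by
  constructor
  · intro hz i m
    obtain ⟨k, -, a, h⟩ := hz i m
    obtain ⟨j, rfl⟩ := hs _ a
    obtain ⟨E, L, -, h2⟩ := tower_word B y ℓ e hℓ σ hσ n k
    rw [h2] at h
    obtain ⟨k', -, h3⟩ := factorAt_infix h
    rw [factorAt_length] at h3
    exact ⟨_, h3⟩
  · intro hz i m
    obtain ⟨i', h⟩ := hz i m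
    obtain ⟨K, hK⟩ := tower_lang B y ℓ e hℓ σ hσ hrec hs n i' m
    exact ⟨K + 1, by omega, y _ 0, h ▸ hK (K + 1) (by omega) _⟩

theorem tower_prim (B : ℕ → Type) (y : ∀ n, ℤ → B n) (ℓ : ℕ → ℕ) (e : ℕ → ℤ)
    (hℓ : ∀ n, 2 ≤ ℓ n)
    (σ : ∀ n, B (n+1) → List (B n))
    (hσ : ∀ n j, σ n (y (n+1) j) = factorAt (y n) (e n + j * ℓ n) (ℓ n))
    (hrec : ∀ n (i : ℤ) (m : ℕ), ∃ M : ℕ, 0 < M ∧ ∀ t : ℕ, t < m → ∀ k : ℤ,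
      y n (i + t + k * M) = y n (i + t))
    (hs : ∀ n, Function.Surjective (y n))
    [∀ n, Finite (B n)] : PrimitiveSeq σ := by
  intro n
  have := Fintype.ofFinite (B n)
  have h : ∀ b : B n, ∃ K : ℕ, ∀ k, K ≤ k → ∀ a : B (n + k), b ∈ sadicWordAux σ n k a := by
    intro b
    obtain ⟨i, rfl⟩ := hs n b
    obtain ⟨K, hK⟩ := tower_lang B y ℓ e hℓ σ hσ hrec hs n i 1
    refine ⟨K, fun k hk a => (hK k hk a).subset ?_⟩
    simp [factorAt_def]
  choose K hK using h
  exact ⟨Finset.univ.sup K + 1, by omega, fun a b =>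
    hK b _ ((Finset.le_sup (Finset.mem_univ b)).trans (Nat.le_succ _)) a⟩

theorem tower_factors (B : ℕ → Type) (y : ∀ n, ℤ → B n) (ℓ : ℕ → ℕ) (e : ℕ → ℤ)
    (hℓ : ∀ n, 2 ≤ ℓ n)
    (σ : ∀ n, B (n+1) → List (B n))
    (hσ : ∀ n j, σ n (y (n+1) j) = factorAt (y n) (e n + j * ℓ n) (ℓ n))
    (hrec : ∀ n (i : ℤ) (m : ℕ), ∃ M : ℕ, 0 < M ∧ ∀ t : ℕ, t < m → ∀ k : ℤ,
      y n (i + t + k * M) = y n (i + t))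
    (hs : ∀ n, Function.Surjective (y n))
    (n : ℕ) (z : ℤ → B n) (y₁ : ℤ → B (n+1)) (k : ℤ)
    (hy₁ : y₁ ∈ XLevel σ (n+1))
    (h : ∀ (j : ℤ) (t : ℕ), t < ℓ n → (σ n (y₁ j))[t]? = some (z (j * ℓ n + t - k))) (i : ℤ) (m : ℕ) :
    ∃ i' : ℤ, factorAt z i m = factorAt (y n) i' m := by
  have hl := hℓ n
  obtain ⟨j0, t0, h0, h1, e0⟩ := blk (q := ℓ n) (by omega) 0 (i + k)
  obtain ⟨j1, hj1⟩ := (tower_XLevel B y ℓ e hℓ σ hσ hrec hs (n+1) y₁).1 hy₁ j0 (m + 1)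
  rw [factorAt_eq_iff] at hj1
  refine ⟨e n + j1 * ℓ n + t0, ?_⟩
  rw [factorAt_eq_iff]
  intro r hr
  obtain ⟨s, t, h2, h3, e1⟩ := blk (q := ℓ n) (by omega) 0 (t0 + r)
  have hs0 : 0 ≤ s := by
    by_contra hneg
    have : s * ℓ n ≤ (-1) * ℓ n := mul_le_mul_of_nonneg_right (by omega) (by omega)
    omega
  have hsm : s < m + 1 := by
    by_contra hneg
    have : ((m : ℤ) + 1) * ℓ n ≤ s * ℓ n := mul_le_mul_of_nonneg_right (by omega) (by omega)
    have h4 : (m : ℤ) * 1 ≤ m * ℓ n := mul_le_mul_of_nonneg_left (by omega) (by omega)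
    rw [add_mul] at this
    omega
  have a1 := h (j0 + s) t.toNat (by omega)
  have a2 := hj1 s.toNat (by omega)
  rw [Int.toNat_of_nonneg hs0] at a2
  rw [a2, hσ, factorAt_getElem? _ _ _ _ (by omega), Int.toNat_of_nonneg h2] at a1
  have a3 := Option.some.inj a1
  rw [show i + r = (j0 + s) * ℓ n + t - k by linarith, ← a3]
  congr 1
  linarith

theorem tower_rec (B : ℕ → Type) (y : ∀ n, ℤ → B n) (ℓ : ℕ → ℕ) (e : ℕ → ℤ)
    (hℓ : ∀ n, 2 ≤ ℓ n)
    (σ : ∀ n, B (n+1) → List (B n))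
    (hσ : ∀ n j, σ n (y (n+1) j) = factorAt (y n) (e n + j * ℓ n) (ℓ n))
    (hrec : ∀ n (i : ℤ) (m : ℕ), ∃ M : ℕ, 0 < M ∧ ∀ t : ℕ, t < m → ∀ k : ℤ,
      y n (i + t + k * M) = y n (i + t))
    (hs : ∀ n, Function.Surjective (y n))
    (hap : ∀ n, IsAperiodicPoint (y n))
    (hcard : ∀ n (a b c : B (n+1)), a = b ∨ b = c ∨ a = c)
    (hinj : ∀ n, Function.Injective (σ n)) : RecognizableSeq σ := by
  intro n x y₁ y₂ k₁ k₂ h₁ h₂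
  have hl := hℓ n
  have len : ∀ a, (σ n a).length = ℓ n := by
    intro a
    obtain ⟨j, rfl⟩ := hs _ a
    rw [hσ, factorAt_length]
  have key : ∀ (y₁ : ℤ → B (n+1)) (k₁ : ℕ), IsCenteredRep (σ n) (XLevel σ (n+1)) x y₁ k₁ →
      ∀ (j : ℤ) (t : ℕ), t < ℓ n → (σ n (y₁ j))[t]? = some (x (j * ℓ n + t - k₁)) := by
    rintro y₁ k₁ ⟨-, -, cc, c0, c1, c2⟩ j t ht
    have hcc : ∀ j, cc j = j * ℓ n := by
      intro j
      induction j with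
      | zero => simpa using c0
      | succ j ih => rw [c1, ih, len]; ring
      | pred j ih =>
        have := c1 (-j - 1)
        rw [len, show (-(j : ℤ) - 1 + 1) = -j by ring, ih] at this
        linarith
    have := c2 j ⟨t, by rw [len]; exact ht⟩
    simp only [hcc] at this
    rw [this, List.getElem?_eq_getElem (by rw [len]; exact ht)]
    rfl
  have hxap : IsAperiodicPoint (fun i => some (x i)) := by
    have := aperiodic_of_factors (hrec n) (hap n)
      (tower_factors B y ℓ e hℓ σ hσ hrec hs n x y₁ k₁ h₁.1 (key y₁ k₁ h₁))
    rintro ⟨p, hp, h⟩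
    exact this ⟨p, hp, fun i => Option.some.inj (h i)⟩
  have conv : ∀ (y₁ : ℤ → B (n+1)) (k₁ : ℕ), IsCenteredRep (σ n) (XLevel σ (n+1)) x y₁ k₁ →
      ∀ j t : ℤ, 0 ≤ t → t < ℓ n → some (x (-(k₁ : ℤ) + j * ℓ n + t)) = (σ n (y₁ j))[t.toNat]? := by
    intro y₁ k₁ h j t h0 h1
    rw [key y₁ k₁ h j t.toNat (by omega), Int.toNat_of_nonneg h0]
    congr 2; ring
  have hd := two_phase_dvd hxap (hcard n) (fun a t => (σ n a)[t.toNat]?) (ℓ n) (by omega)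
    y₁ y₂ (-k₁) (-k₂) (conv y₁ k₁ h₁) (conv y₂ k₂ h₂)
  have b1 := h₁.2.1
  have b2 := h₂.2.1
  rw [len] at b1 b2
  have hk : k₁ = k₂ := by
    have := Int.eq_zero_of_abs_lt_dvd hd (by rw [abs_lt]; constructor <;> omega)
    omega
  refine ⟨?_, hk⟩
  subst hk
  funext j
  apply hinj n
  apply List.ext_getElem?
  intro t
  by_cases ht : t < ℓ n
  · rw [key y₁ k₁ h₁ j t ht, key y₂ k₁ h₂ j t ht]
  · rw [List.getElem?_eq_none (by rw [len]; omega), List.getElem?_eq_none (by rw [len]; omega)]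

end Tower

theorem tower_main {x : ℤ → A} (hx : IsAperiodicPoint x) (hT : IsToeplitz x)
    (q : ℕ → ℕ) (c : ℕ → ℤ) (B : ℕ → Type) [∀ n, Finite (B n)] (y : ∀ n, ℤ → B n)
    (hq0 : ∀ n, 0 < q n) (hlt : ∀ n, q n < q (n+1)) (hdvd : ∀ n, q n ∣ q (n+1))
    (hc : ∀ n, (q n : ℤ) ∣ c (n+1) - c n)
    (hy : ∀ n (j j' : ℤ), y n j = y n j' ↔
      ∀ t : ℕ, t < q n → x (c n + j * q n + t) = x (c n + j' * q n + t))
    (hpre : ∀ n (j j' : ℤ) (t : ℕ), t < q n →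
      x (c (n+1) + j * q (n+1) + t) = x (c (n+1) + j' * q (n+1) + t))
    (hsuf : ∀ n (j j' : ℤ) (t : ℕ), q (n+1) ≤ t + q n → t < q (n+1) →
      x (c (n+1) + j * q (n+1) + t) = x (c (n+1) + j' * q (n+1) + t))
    (hs : ∀ n, Function.Surjective (y n))
    (hcard : ∀ n (a b c : B (n+1)), a = b ∨ b = c ∨ a = c) :
    ∃ σ : ∀ n, B (n+1) → List (B n), NonErasing σ ∧ ConstantLength σ ∧ PrimitiveSeq σ ∧
      ProperSeq σ ∧ RecognizableSeq σ ∧ ∀ z, z ∈ XLevel σ 0 ↔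
        ∀ (i : ℤ) (m : ℕ), ∃ i' : ℤ, factorAt z i m = factorAt (y 0) i' m := by
  choose ℓ hqℓ using hdvd
  choose e hce using hc
  have hℓ : ∀ n, 2 ≤ ℓ n := by
    intro n
    by_contra h
    have h1 := hlt n
    rw [hqℓ] at h1
    have : q n * ℓ n ≤ q n * 1 := Nat.mul_le_mul_left _ (by omega)
    omega
  -- positions
  have pos : ∀ n (j : ℤ) (s t : ℕ),
      c n + (e n + j * ℓ n + s) * q n + t = c (n+1) + j * q (n+1) + ((s * q n + t : ℕ) : ℤ) := by
    intro n j s t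
    rw [show c (n+1) = c n + q n * e n by linarith [hce n], hqℓ]
    push_cast; ring
  have slt : ∀ n (s t : ℕ), s < ℓ n → t < q n → s * q n + t < q (n+1) := by
    intro n s t h1 h2
    rw [hqℓ]
    calc s * q n + t < s * q n + q n := by omega
      _ = q n * (s + 1) := by ring
      _ ≤ q n * ℓ n := Nat.mul_le_mul_left _ h1
  have K : ∀ n (j j' : ℤ), y (n+1) j = y (n+1) j' ↔
      ∀ s : ℕ, s < ℓ n → y n (e n + j * ℓ n + s) = y n (e n + j' * ℓ n + s) := by
    intro n j j'
    rw [hy]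
    constructor
    · intro h s hs
      rw [hy]
      intro t ht
      rw [pos, pos]
      exact h _ (slt n s t hs ht)
    · intro h t ht
      have h1 : t / q n < ℓ n := by
        rw [Nat.div_lt_iff_lt_mul (hq0 n), mul_comm, ← hqℓ]; exact ht
      have h2 := (hy _ _ _).1 (h _ h1) (t % q n) (Nat.mod_lt _ (hq0 n))
      rw [pos, pos, Nat.div_add_mod'] at h2
      exact h2
  have hrec : ∀ n (i : ℤ) (m : ℕ), ∃ M : ℕ, 0 < M ∧ ∀ t : ℕ, t < m → ∀ k : ℤ,
      y n (i + t + k * M) = y n (i + t) := by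
    intro n i m
    obtain ⟨M, hM, h⟩ := toeplitz_window hT (c n + i * q n) (m * q n)
    refine ⟨M, hM, fun t ht k => ?_⟩
    rw [hy]
    intro s hs
    have hb : t * q n + s < m * q n := by
      calc t * q n + s < t * q n + q n := by omega
        _ = (t + 1) * q n := by ring
        _ ≤ m * q n := Nat.mul_le_mul_right _ ht
    have := h (t * q n + s) hb (k * q n)
    push_cast at this
    rw [show c n + (i + t + k * M) * q n + s = c n + i * q n + (t * q n + s) + k * q n * M by ring,
      this]
    congr 1; ring
  have hap : ∀ n, IsAperiodicPoint (y n) := by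
    rintro n ⟨P, hP, h⟩
    obtain ⟨i, hi⟩ := per_int hx (P * q n) (by have := hq0 n; positivity)
    obtain ⟨j, t, h0, h1, rfl⟩ := blk (q := q n) (by exact_mod_cast hq0 n) (c n) i
    apply hi
    have := (hy n _ _).1 (h j) t.toNat (by omega)
    rw [Int.toNat_of_nonneg h0] at this
    rw [← this]
    congr 1; ring
  let g : ∀ n, B n → ℤ := fun n => Function.surjInv (hs n)
  have hg : ∀ n a, y n (g n a) = a := fun n a => Function.surjInv_eq (hs n) a
  let σ : ∀ n, B (n+1) → List (B n) := fun n a =>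
    factorAt (y n) (e n + g (n+1) a * ℓ n) (ℓ n)
  have hσ : ∀ n j, σ n (y (n+1) j) = factorAt (y n) (e n + j * ℓ n) (ℓ n) := by
    intro n j
    show factorAt _ _ _ = _
    rw [factorAt_eq_iff]
    exact (K n _ _).1 (hg _ _)
  have len : ∀ n a, (σ n a).length = ℓ n := fun n a => factorAt_length _ _ _
  refine ⟨σ, ?_, ?_, tower_prim B y ℓ e hℓ σ hσ hrec hs, ?_, ?_, ?_⟩
  · intro n a h
    have := len n a
    have := hℓ n
    rw [h] at *
    simp at *
    omega
  · intro n a b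
    rw [len, len]
  · intro n
    have hl := hℓ n
    refine ⟨y n (e n), y n (e n + ((ℓ n - 1 : ℕ) : ℤ)), fun a => ?_⟩
    obtain ⟨j, rfl⟩ := hs _ a
    rw [hσ, List.head?_eq_getElem?, List.getLast?_eq_getElem?, factorAt_length,
      factorAt_getElem? _ _ _ _ (by omega), factorAt_getElem? _ _ _ _ (by omega)]
    constructor
    · congr 1
      have := (hy n (e n + j * ℓ n + (0 : ℕ)) (e n + 0 * ℓ n + (0 : ℕ))).2 (fun t ht => by
        rw [pos, pos]
        apply hpre
        simpa using ht)
      simpa using this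
    · congr 1
      have := (hy n (e n + j * ℓ n + (ℓ n - 1 : ℕ)) (e n + 0 * ℓ n + (ℓ n - 1 : ℕ))).2
        (fun t ht => by
          rw [pos, pos]
          apply hsuf
          · have : (ℓ n - 1) * q n + q n = q (n+1) := by
              rw [hqℓ, ← Nat.succ_mul, Nat.succ_eq_add_one, Nat.sub_add_cancel (by omega), mul_comm]
            omega
          · exact slt n _ t (by omega) ht)
      simpa using this
  · refine tower_rec B y ℓ e hℓ σ hσ hrec hs hap hcard ?_
    intro n a b hab
    obtain ⟨j, rfl⟩ := hs _ a
    obtain ⟨j', rfl⟩ := hs _ b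
    rw [hσ, hσ, factorAt_eq_iff] at hab
    exact (K n j j').2 hab
  · exact tower_XLevel B y ℓ e hℓ σ hσ hrec hs 0

theorem skel_some {x : ℤ → A} {p : ℕ} {i : ℤ} {a : A} :
    Skel x p i = some a ↔ i ∈ PerSet x p ∧ x i = a := by
  unfold Skel
  split <;> simp_all

theorem skel_of_mem {x : ℤ → A} {p : ℕ} {i : ℤ} (h : i ∈ PerSet x p) :
    Skel x p i = some (x i) := skel_some.2 ⟨h, rfl⟩

theorem perSet_mono {x : ℤ → A} {p m : ℕ} (h : p ∣ m) : PerSet x p ⊆ PerSet x m := by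
  obtain ⟨k, rfl⟩ := h
  intro i hi j
  have := hi (j * k)
  rw [← this]; push_cast; congr 1; ring

theorem perSet_add {x : ℤ → A} {p : ℕ} {i : ℤ} (h : i ∈ PerSet x p) (k : ℤ) :
    i + k * p ∈ PerSet x p := by
  intro j
  rw [h k, ← h (k + j)]; congr 1; ring

theorem perSet_add_iff {x : ℤ → A} {p : ℕ} {i : ℤ} (k : ℤ) :
    i + k * p ∈ PerSet x p ↔ i ∈ PerSet x p := by
  refine ⟨fun h => ?_, fun h => perSet_add h k⟩
  have := perSet_add h (-k)
  rwa [show i + k * p + -k * p = i by ring] at this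

theorem opt_ext {o o' : Option A} (h : ∀ a, o = some a ↔ o' = some a) : o = o' := by
  cases o with
  | none => 
    cases o' with
    | none => rfl
    | some b => exact absurd ((h b).2 rfl) (by simp)
  | some b => exact ((h b).1 rfl).symm

theorem skel_add {x : ℤ → A} {p : ℕ} (i k : ℤ) : Skel x p (i + k * p) = Skel x p i := by
  apply opt_ext
  intro a
  rw [skel_some, skel_some, perSet_add_iff]
  constructor
  · rintro ⟨h, rfl⟩; exact ⟨h, (h k).symm⟩
  · rintro ⟨h, rfl⟩; exact ⟨h, h k⟩

/-- Skeleton values in terms of skeleton values at a finer level. -/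
theorem skel_some_iff {x : ℤ → A} {p m : ℕ} (h : p ∣ m) {i : ℤ} {a : A} :
    Skel x p i = some a ↔ ∀ k : ℤ, i + k * p ∈ PerSet x p ∧ Skel x m (i + k * p) = some a := by
  constructor
  · intro h1 k
    have h2 := skel_add (x := x) (p := p) i k
    rw [h1, skel_some] at h2
    exact ⟨h2.1, skel_some.2 ⟨perSet_mono h h2.1, h2.2⟩⟩
  · intro h1
    have := h1 0
    simp only [zero_mul, add_zero] at this
    exact skel_some.2 ⟨this.1, (skel_some.1 this.2).2⟩

theorem skel_some_iff_of_dvd {x : ℤ → A} {p m : ℕ} (h : p ∣ m) {i : ℤ} {a : A} :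
    Skel x p i = some a ↔ ∀ k : ℤ, Skel x m (i + k * p) = some a := by
  constructor
  · intro h1 k
    exact ((skel_some_iff h).1 h1 k).2
  · intro h1
    have h2 : ∀ k : ℤ, x (i + k * p) = a := fun k => (skel_some.1 (h1 k)).2
    have h0 := h2 0
    simp only [zero_mul, add_zero] at h0
    exact skel_some.2 ⟨fun k => by rw [h2, h0], h0⟩

theorem skel_period_of_dvd {x : ℤ → A} {p m : ℕ} (h : p ∣ m) {r : ℤ}
    (hr : ∀ i, Skel x m (i + r) = Skel x m i) (i : ℤ) : Skel x p (i + r) = Skel x p i := by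
  apply opt_ext
  intro a
  rw [skel_some_iff_of_dvd h, skel_some_iff_of_dvd h]
  refine forall_congr' fun k => ?_
  rw [show i + r + k * p = i + k * p + r by ring, hr]

theorem IsEssentialPeriod.dvd {x : ℤ → A} {p : ℕ} (h : IsEssentialPeriod x p) {r : ℤ}
    (hr : ∀ i, Skel x p (i + r) = Skel x p i) : (p : ℤ) ∣ r := by
  by_contra hc
  have hp : (0 : ℤ) < p := by have := h.1; omega
  have h1 := Int.emod_nonneg r hp.ne'
  have h2 := Int.emod_lt_of_pos r hp
  have h3 : r % p ≠ 0 := fun e => hc (Int.dvd_of_emod_eq_zero e)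
  obtain ⟨i, hi⟩ := h.2 (r % p).toNat (by omega) (by omega)
  apply hi
  rw [Int.toNat_of_nonneg h1]
  have e := Int.mul_ediv_add_emod r p
  rw [← skel_add (i + r % p) (r / p), ← hr i]
  congr 1; linarith

theorem isEssential_iff {x : ℤ → A} {p : ℕ} (hp : 1 < p) :
    IsEssentialPeriod x p ↔ ∀ r : ℤ, (∀ i, Skel x p (i + r) = Skel x p i) → (p : ℤ) ∣ r := by
  refine ⟨fun h r hr => h.dvd hr, fun h => ⟨hp, fun q h0 h1 => ?_⟩⟩
  by_contra hc
  push Not at hc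
  have := Int.le_of_dvd (by omega) (h q hc)
  omega

theorem IsEssentialPeriod.lcm {x : ℤ → A} {p p' : ℕ} (h : IsEssentialPeriod x p)
    (h' : IsEssentialPeriod x p') : IsEssentialPeriod x (Nat.lcm p p') := by
  have := h.1
  have := h'.1
  have h1 : 1 < Nat.lcm p p' :=
    lt_of_lt_of_le h.1 (Nat.le_of_dvd (Nat.lcm_pos (by omega) (by omega)) (Nat.dvd_lcm_left _ _))
  rw [isEssential_iff h1]
  intro r hr
  have a := h.dvd (skel_period_of_dvd (Nat.dvd_lcm_left p p') hr)
  have b := h'.dvd (skel_period_of_dvd (Nat.dvd_lcm_right p p') hr)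
  rw [Int.natCast_dvd] at *
  exact Nat.lcm_dvd a b

theorem exists_essential {x : ℤ → A} (hx : IsAperiodicPoint x) {p : ℕ} (hp : 1 < p) {i : ℤ}
    (hi : i ∈ PerSet x p) : ∃ p', IsEssentialPeriod x p' ∧ i ∈ PerSet x p' := by
  classical
  have hex : ∃ r : ℕ, 0 < r ∧ ∀ i, Skel x p (i + r) = Skel x p i :=
    ⟨p, by omega, fun i => by simpa using skel_add (x := x) (p := p) i 1⟩
  obtain ⟨hr0, hr⟩ := Nat.find_spec hex
  have hmin := fun m h => Nat.find_min hex (m := m) h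
  set r := Nat.find hex with hrdef
  have hr' : ∀ i k : ℤ, Skel x p (i + k * r) = Skel x p i := fun i k => per_mul hr k i
  have sub : ∀ j, j ∈ PerSet x p → j ∈ PerSet x r := by
    intro j hj k
    have := hr' j k
    rw [skel_of_mem hj, skel_some] at this
    exact this.2
  -- r divides p
  have hrp : r ∣ p := by
    by_contra hc
    have h3 : 0 < p % r := Nat.pos_of_ne_zero fun e => hc (Nat.dvd_of_mod_eq_zero e)
    apply hmin (p % r) (Nat.mod_lt _ hr0)
    refine ⟨h3, fun i => ?_⟩
    rw [← hr' (i + (p % r : ℕ)) (p / r : ℕ), ← skel_add (x := x) (p := p) i 1]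
    congr 1
    have := Nat.div_add_mod' p r
    zify at this ⊢
    linarith
  have eq : ∀ j, Skel x r j = Skel x p j := by
    intro j
    apply opt_ext
    intro a
    rw [skel_some, skel_some]
    constructor
    · rintro ⟨h, h'⟩; exact ⟨perSet_mono hrp h, h'⟩
    · rintro ⟨h, h'⟩; exact ⟨sub j h, h'⟩
  refine ⟨r, ⟨?_, ?_⟩, sub i hi⟩
  · by_contra h
    have h1 : r = 1 := by omega
    obtain ⟨j, hj⟩ := per_int hx 1 one_pos
    apply hj
    have h2 := sub i hi
    rw [h1] at h2
    have a := h2 (j + 1 - i)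
    have b := h2 (j - i)
    rw [Nat.cast_one, mul_one, add_sub_cancel] at a b
    rw [a, b]
  · intro s h0 h1
    have := hmin s h1
    push Not at this
    obtain ⟨j, hj⟩ := this h0
    exact ⟨j, by rw [eq, eq]; exact hj⟩

theorem exists_essential_next {x : ℤ → A} (hx : IsAperiodicPoint x) (hT : IsToeplitz x) {p : ℕ}
    (hp : IsEssentialPeriod x p) (i : ℤ) :
    ∃ p', IsEssentialPeriod x p' ∧ p ∣ p' ∧ p < p' ∧ i ∈ PerSet x p' := by
  have key : ∀ p i, IsEssentialPeriod x p → ∃ p', IsEssentialPeriod x p' ∧ p ∣ p' ∧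
      i ∈ PerSet x p' := by
    intro p i hp
    obtain ⟨p1, h1, h2⟩ := hT i
    obtain ⟨p2, h3, h4⟩ := exists_essential hx h1 h2
    exact ⟨_, hp.lcm h3, Nat.dvd_lcm_left _ _, perSet_mono (Nat.dvd_lcm_right _ _) h4⟩
  have hp1 := hp.1
  obtain ⟨i0, hi0⟩ := per_int hx p (by omega)
  obtain ⟨p1, a1, a2, a3⟩ := key p i0 hp
  obtain ⟨p2, b1, b2, b3⟩ := key p1 i a1
  have h1 := b1.1
  refine ⟨p2, b1, a2.trans b2, ?_, b3⟩
  refine lt_of_le_of_ne (Nat.le_of_dvd (by omega) (a2.trans b2)) ?_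
  rintro rfl
  apply hi0
  have := perSet_mono b2 a3 1
  simpa using this

theorem exists_periodStructure {x : ℤ → A} (hx : IsAperiodicPoint x) (hT : IsToeplitz x) :
    ∃ P, IsPeriodStructure x P := by
  obtain ⟨f, hf⟩ := exists_surjective_nat ℤ
  obtain ⟨p0, h0, h0'⟩ := hT 0
  obtain ⟨p1, h1, -⟩ := exists_essential hx h0 h0'
  choose! nx ha hb hc hd using fun (p : ℕ) (hp : IsEssentialPeriod x p) (i : ℤ) =>
    exists_essential_next hx hT hp i
  let P : ℕ → ℕ := fun n => Nat.rec p1 (fun n p => nx p (f n)) n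
  have hP : ∀ n, IsEssentialPeriod x (P n) := by
    intro n
    induction n with
    | zero => exact h1
    | succ n ih => exact ha _ ih _
  refine ⟨P, strictMono_nat_of_lt_succ fun n => hc _ (hP n) _, hP, fun n => hb _ (hP n) _, ?_⟩
  intro i
  obtain ⟨n, rfl⟩ := hf i
  exact ⟨n + 1, hd _ (hP n) _⟩

theorem IsPeriodStructure.dvd_of_le {x : ℤ → A} {P : ℕ → ℕ} (h : IsPeriodStructure x P) {m n : ℕ}
    (hmn : m ≤ n) : P m ∣ P n := by
  induction n, hmn using Nat.le_induction with
  | base => exact dvd_rfl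
  | succ n _ ih => exact ih.trans (h.2.2.1 n)

theorem IsPeriodStructure.window {x : ℤ → A} {P : ℕ → ℕ} (h : IsPeriodStructure x P) (i : ℤ)
    (n k : ℕ) : ∃ m, k ≤ m ∧ ∀ t : ℕ, t < n → i + t ∈ PerSet x (P m) := by
  induction n with
  | zero => exact ⟨k, le_rfl, by simp⟩
  | succ n ih =>
    obtain ⟨m, hm, h1⟩ := ih
    obtain ⟨m', h2⟩ := h.2.2.2 (i + n)
    refine ⟨max m m', by omega, fun t ht => ?_⟩
    rcases Nat.lt_succ_iff_lt_or_eq.1 ht with h3 | rfl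
    · exact perSet_mono (h.dvd_of_le (le_max_left _ _)) (h1 t h3)
    · exact perSet_mono (h.dvd_of_le (le_max_right _ _)) h2

theorem dvd_conv {a b c : ℤ} (h : a ∣ b) (e : c = b) : a ∣ c := e ▸ h

theorem ph_unique_of {x : ℤ → A} {q : ℕ} {u v : List A} {i : ℤ} {n : ℕ} (hq : 0 < q)
    (h : ∃! k : ℕ, k < q ∧ Ph x q u v (i + k) i n) {c c' : ℤ} (hc : Ph x q u v c i n)
    (hc' : Ph x q u v c' i n) : (q : ℤ) ∣ c' - c := by
  have hq' : (0 : ℤ) < q := by exact_mod_cast hq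
  have key : ∀ c, Ph x q u v c i n → ∃ k : ℕ, (k < q ∧ Ph x q u v (i + k) i n) ∧
      (q : ℤ) ∣ c - (i + k) := by
    intro c hc
    have h1 := Int.emod_nonneg (c - i) hq'.ne'
    have h2 := Int.emod_lt_of_pos (c - i) hq'
    have h3 : (q : ℤ) ∣ (c - i) - (c - i) % q := Int.dvd_self_sub_emod
    refine ⟨((c - i) % q).toNat, ⟨by omega, hc.congr ?_⟩, ?_⟩
    · rw [Int.toNat_of_nonneg h1, ← dvd_neg]
      exact dvd_conv h3 (by ring)
    · rw [Int.toNat_of_nonneg h1]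
      exact dvd_conv h3 (by ring)
  obtain ⟨k, hk, d⟩ := key c hc
  obtain ⟨k', hk', d'⟩ := key c' hc'
  obtain rfl := h.unique hk hk'
  have := dvd_sub d' d
  exact dvd_conv this (by ring)

theorem gph_of_unique {x : ℤ → A} {q r : ℕ} {u v : List A} (hq : 0 < q) (hqr : q < r)
    (hu : u.length = q) (hv : v.length = q)
    (h2 : ∀ i, UniquelyBuiltFrom {u, v} (factorAt x i (2 * r)))
    (h4 : ∀ i, UniquelyBuiltFrom {u, v} (factorAt x i (4 * r))) : ∃ c, GPh x q u v c := by
  have h2 : ∀ i, ∃! k : ℕ, k < q ∧ Ph x q u v (i + k) i (2 * r) :=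
    fun i => (uniquelyBuilt_iff hu hv (by omega)).1 (h2 i)
  have h4 : ∀ i, ∃! k : ℕ, k < q ∧ Ph x q u v (i + k) i (4 * r) :=
    fun i => (uniquelyBuilt_iff hu hv (by omega)).1 (h4 i)
  have ex : ∀ i, ∃ c, Ph x q u v c i (2 * r) := fun i => by
    obtain ⟨k, hk, -⟩ := h2 i
    exact ⟨_, hk.2⟩
  choose K hK using ex
  have st : ∀ i, (q : ℤ) ∣ K (i + 1) - K i := by
    intro i
    obtain ⟨k, hk, -⟩ := h4 i
    have a := ph_unique_of hq (h2 i) (hK i) (hk.2.mono le_rfl (by omega))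
    have b := ph_unique_of hq (h2 (i+1)) (hK (i+1)) (hk.2.mono (by omega) (by push_cast; omega))
    have := dvd_sub a b
    exact dvd_conv this (by ring)
  have all : ∀ i, (q : ℤ) ∣ K 0 - K i := by
    intro i
    induction i using Int.induction_on with
    | zero => simp
    | succ i ih =>
      have := dvd_sub ih (st i)
      exact dvd_conv this (by ring)
    | pred i ih =>
      have := dvd_add ih (st (-(i:ℤ) - 1))
      rw [sub_add_cancel] at this
      exact dvd_conv this (by ring)
  refine ⟨K 0, fun j => ?_⟩
  obtain ⟨w, hw, h⟩ := (hK (K 0 + j * q)).congr (all _) j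
  exact ⟨w, hw, fun t ht => h t ht (by omega) (by push_cast; omega)⟩

theorem step_lemma [TopologicalSpace A] [DiscreteTopology A] {x : ℤ → A} 
    (hR : ∀ p : ℕ, 0 < p → DividesScale (closure (orbit x)) p → ∀ m : ℕ,
        ∃ (q r : ℕ) (u v : List A), 0 < q ∧
          u.length = q ∧ v.length = q ∧
          p ∣ q ∧ DividesScale (closure (orbit x)) q ∧ q < r ∧
          CommonPrefixLongerThan u v m ∧ CommonSuffixLongerThan u v m ∧
          ∀ w ∈ Lang (2*r) (closure (orbit x)) ∪ Lang (4*r) (closure (orbit x)), 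
            UniquelyBuiltFrom {u, v} w)
    (q : ℕ) (c : ℤ) (hq : 0 < q) (hD : DividesScale (closure (orbit x)) q) :
    ∃ (q' : ℕ) (c' : ℤ) (y : ℤ → Bool), 0 < q' ∧ DividesScale (closure (orbit x)) q' ∧ q < q' ∧
      q ∣ q' ∧ (q : ℤ) ∣ c' - c ∧ 
      (∀ j j', y j = y j' ↔ ∀ t : ℕ, t < q' → x (c' + j * q' + t) = x (c' + j' * q' + t)) ∧
      (∀ (j j' : ℤ) (t : ℕ), t < q → x (c' + j * q' + t) = x (c' + j' * q' + t)) ∧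
      (∀ (j j' : ℤ) (t : ℕ), q' ≤ t + q → t < q' →
        x (c' + j * q' + t) = x (c' + j' * q' + t)) := by
  classical
  obtain ⟨q', r, u, v, hq', hu, hv, hdvd, hD', hqr, hpre, hsuf, hb⟩ := hR q hq hD (2 * q)
  obtain ⟨c0, hG⟩ := gph_of_unique (x := x) hq' hqr hu hv
    (fun i => hb _ (Or.inl ((mem_Lang _ _ _).2 ⟨i, rfl⟩)))
    (fun i => hb _ (Or.inr ((mem_Lang _ _ _).2 ⟨i, rfl⟩)))
  have hqz : (0 : ℤ) < q := by exact_mod_cast hq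
  have d0 := Int.emod_nonneg (c - c0) hqz.ne'
  have d1 := Int.emod_lt_of_pos (c - c0) hqz
  have d2 : (q : ℤ) ∣ (c - c0) - (c - c0) % q := Int.dvd_self_sub_emod
  obtain ⟨d, hd⟩ := Int.eq_ofNat_of_zero_le d0
  rw [hd] at d1 d2
  choose f hf hf' using hG
  have pre : ∀ t, t ≤ 2 * q → u[t]? = v[t]? := by
    intro t ht
    have := congrArg (fun l => l[t]?) hpre.2.2
    simpa [List.getElem?_take, show t < 2 * q + 1 by omega] using this
  have suf : ∀ t, t < q' → q' ≤ t + 2 * q + 1 → u[t]? = v[t]? := by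
    intro t ht h
    have := congrArg (fun l => l[q' - 1 - t]?) hsuf.2.2
    simp only [List.getElem?_take, show q' - 1 - t < 2 * q + 1 by omega, if_true] at this
    rw [List.getElem?_reverse (by omega), List.getElem?_reverse (by omega), hu, hv] at this
    rwa [show q' - 1 - (q' - 1 - t) = t by omega] at this
  have len : 2 * q + 1 ≤ q' := by have := hpre.1; omega
  have pre' : ∀ j j' t, t ≤ 2 * q → (f j)[t]? = (f j')[t]? := by
    intro j j' t ht
    have := pre t ht
    rcases hf j with h | h <;> rcases hf j' with h' | h' <;> rw [h, h'] <;> simp [this]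
  have suf' : ∀ j j' t, t < q' → q' ≤ t + 2 * q + 1 → (f j)[t]? = (f j')[t]? := by
    intro j j' t ht h1
    have := suf t ht h1
    rcases hf j with h | h <;> rcases hf j' with h' | h' <;> rw [h, h'] <;> simp [this]
  have pre2 : ∀ (j j' : ℤ) (t : ℕ), t ≤ 2 * q → x (c0 + j * q' + t) = x (c0 + j' * q' + t) := by
    intro j j' t ht
    have := pre' j j' t ht
    rw [hf' _ _ (by omega), hf' _ _ (by omega)] at this
    exact Option.some.inj this
  have suf2 : ∀ (j j' : ℤ) (t : ℕ), t < q' → q' ≤ t + 2 * q + 1 →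
      x (c0 + j * q' + t) = x (c0 + j' * q' + t) := by
    intro j j' t ht h1
    have := suf' j j' t ht h1
    rw [hf' _ _ (by omega), hf' _ _ (by omega)] at this
    exact Option.some.inj this
  have feq : ∀ j j', f j = f j' ↔ ∀ t : ℕ, t < q' → x (c0 + j * q' + t) = x (c0 + j' * q' + t) := by
    intro j j'
    constructor
    · intro h t ht
      have := congrArg (fun l => l[t]?) h
      simp only [hf' _ _ ht] at this
      exact Option.some.inj this
    · intro h
      have L : ∀ j, (f j).length = q' := by
        intro j; rcases hf j with h | h <;> rw [h] <;> assumption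
      apply List.ext_getElem?
      intro t
      by_cases ht : t < q'
      · rw [hf' _ _ ht, hf' _ _ ht, h t ht]
      · rw [List.getElem?_eq_none (by rw [L]; omega), List.getElem?_eq_none (by rw [L]; omega)]
  refine ⟨q', c0 + d, fun j => decide (f j = u), hq', hD', by omega, hdvd, ?_, ?_, ?_, ?_⟩
  · rw [← dvd_neg]
    exact dvd_conv d2 (by ring)
  · intro j j'
    have e1 : decide (f j = u) = decide (f j' = u) ↔ f j = f j' := by
      rw [decide_eq_decide]
      constructor
      · intro h
        rcases hf j with a | a
        · rw [a, h.1 a]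
        · rcases hf j' with b | b
          · rw [b, h.2 b]
          · rw [a, b]
      · intro h; rw [h]
    rw [e1, feq]
    constructor
    · intro h t ht
      by_cases h1 : d + t < q'
      · have := h (d + t) h1
        push_cast at this
        rw [show c0 + d + j * q' + t = c0 + j * q' + (d + t) by ring, this]
        congr 1; ring
      · have := pre2 (j + 1) (j' + 1) (d + t - q') (by omega)
        rw [Nat.cast_sub (by omega)] at this
        push_cast at this
        rw [show c0 + d + j * q' + t = c0 + (j + 1) * q' + (d + t - q') by ring, this]
        congr 1; ring
    · intro h t ht
      by_cases h1 : d ≤ t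
      · have := h (t - d) (by omega)
        rw [Nat.cast_sub (by omega)] at this
        rw [show c0 + j * q' + t = c0 + d + j * q' + (t - d) by ring, this]
        congr 1; ring
      · exact pre2 j j' t (by omega)
  · intro j j' t ht
    have := pre2 j j' (d + t) (by omega)
    push_cast at this
    rw [show c0 + d + j * q' + t = c0 + j * q' + (d + t) by ring, this]
    congr 1; ring
  · intro j j' t h1 ht
    by_cases h2 : d + t < q'
    · have := suf2 j j' (d + t) h2 (by omega)
      push_cast at this
      rw [show c0 + d + j * q' + t = c0 + j * q' + (d + t) by ring, this]
      congr 1; ring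
    · have := pre2 (j + 1) (j' + 1) (d + t - q') (by omega)
      rw [Nat.cast_sub (by omega)] at this
      push_cast at this
      rw [show c0 + d + j * q' + t = c0 + (j + 1) * q' + (d + t - q') by ring, this]
      congr 1; ring

theorem conj_lemma [TopologicalSpace A] [DiscreteTopology A] {K : Type} (x : ℤ → A) (f : K → A)
    (g : A → K) (hgf : ∀ b, g (f b) = b) (y : ℤ → K) (hxy : ∀ i, x i = f (y i))
    (Y : Set (ℤ → K)) (hY : ∀ z, z ∈ Y ↔ ∀ (i : ℤ) (m : ℕ), ∃ i' : ℤ,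
      factorAt z i m = factorAt y i' m) :
    @Conjugate A K _ ⊥ (closure (orbit x)) Y := by
  let _ : TopologicalSpace K := ⊥
  have : DiscreteTopology K := ⟨rfl⟩
  have hgx : ∀ i, g (x i) = y i := fun i => by rw [hxy, hgf]
  have h1 : ∀ z ∈ closure (orbit x), (fun i => g (z i)) ∈ Y := by
    intro z hz
    rw [hY]
    intro i m
    obtain ⟨i', h⟩ := (mem_closure_orbit x z).1 hz i m
    refine ⟨i', ?_⟩
    rw [factorAt_eq_iff] at h ⊢
    intro t ht
    rw [h t ht, hgx]
  have h2 : ∀ w ∈ Y, (fun i => f (w i)) ∈ closure (orbit x) := by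
    intro w hw
    rw [mem_closure_orbit]
    intro i m
    obtain ⟨i', h⟩ := (hY w).1 hw i m
    refine ⟨i', ?_⟩
    rw [factorAt_eq_iff] at h ⊢
    intro t ht
    rw [h t ht, hxy]
  have h3 : ∀ z ∈ closure (orbit x), ∀ i, f (g (z i)) = z i := by
    intro z hz i
    obtain ⟨i', h⟩ := (mem_closure_orbit x z).1 hz i 1
    rw [factorAt_eq_iff] at h
    have := h 0 one_pos
    simp only [Nat.cast_zero, add_zero] at this
    rw [this, hgx, hxy]
  refine ⟨{ toFun := fun z => ⟨fun i => g (z.1 i), h1 _ z.2⟩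
            invFun := fun w => ⟨fun i => f (w.1 i), h2 _ w.2⟩
            left_inv := fun z => Subtype.ext (funext fun i => h3 _ z.2 i)
            right_inv := fun w => Subtype.ext (funext fun i => hgf _)
            continuous_toFun := ?_
            continuous_invFun := ?_ }, ?_⟩
  · refine Continuous.subtype_mk (continuous_pi fun i => ?_) _
    exact continuous_of_discreteTopology.comp ((continuous_apply i).comp continuous_subtype_val)
  · refine Continuous.subtype_mk (continuous_pi fun i => ?_) _
    exact continuous_of_discreteTopology.comp ((continuous_apply i).comp continuous_subtype_val)
  · intro z hz hz'
    rfl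

/-- The alphabets of the directive sequence. -/
def BB (k : ℕ) : ℕ → Type
  | 0 => Fin k
  | (_ + 1) => Bool

instance BB.fintype (k : ℕ) : ∀ n, Fintype (BB k n)
  | 0 => inferInstanceAs (Fintype (Fin k))
  | (_ + 1) => inferInstanceAs (Fintype Bool)

/-- The level sequences. -/
def BBy (k : ℕ) (y0 : ℤ → Fin k) (y : ℕ → ℤ → Bool) : ∀ n, ℤ → BB k n
  | 0 => y0
  | (n + 1) => y n

theorem backward [Finite A] [TopologicalSpace A] [DiscreteTopology A] {x : ℤ → A} 
    (hx : IsAperiodicPoint x) (hT : IsToeplitz x)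
    (hR : ∀ p : ℕ, 0 < p → DividesScale (closure (orbit x)) p → ∀ m : ℕ,
        ∃ (q r : ℕ) (u v : List A), 0 < q ∧
          u.length = q ∧ v.length = q ∧
          p ∣ q ∧ DividesScale (closure (orbit x)) q ∧ q < r ∧
          CommonPrefixLongerThan u v m ∧ CommonSuffixLongerThan u v m ∧
          ∀ w ∈ Lang (2*r) (closure (orbit x)) ∪ Lang (4*r) (closure (orbit x)), 
            UniquelyBuiltFrom {u, v} w) : IsStrongToeplitzOfRank (closure (orbit x)) 2 := by
  have step : ∀ s : {s : ℕ × ℤ // 0 < s.1 ∧ DividesScale (closure (orbit x)) s.1},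
      ∃ (s' : {s : ℕ × ℤ // 0 < s.1 ∧ DividesScale (closure (orbit x)) s.1}) (y : ℤ → Bool),
        s.1.1 < s'.1.1 ∧ s.1.1 ∣ s'.1.1 ∧ (s.1.1 : ℤ) ∣ s'.1.2 - s.1.2 ∧
      (∀ j j', y j = y j' ↔ ∀ t : ℕ, t < s'.1.1 →
        x (s'.1.2 + j * s'.1.1 + t) = x (s'.1.2 + j' * s'.1.1 + t)) ∧
      (∀ (j j' : ℤ) (t : ℕ), t < s.1.1 →
        x (s'.1.2 + j * s'.1.1 + t) = x (s'.1.2 + j' * s'.1.1 + t)) ∧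
      (∀ (j j' : ℤ) (t : ℕ), s'.1.1 ≤ t + s.1.1 → t < s'.1.1 →
        x (s'.1.2 + j * s'.1.1 + t) = x (s'.1.2 + j' * s'.1.1 + t)) := by
    rintro ⟨⟨q, c⟩, hq, hD⟩
    obtain ⟨q', c', y, a, b, h⟩ := step_lemma hR q c hq hD
    exact ⟨⟨⟨q', c'⟩, a, b⟩, y, h⟩
  choose nx Y h1 h2 h3 h4 h5 h6 using step
  have hD1 : DividesScale (closure (orbit x)) 1 := by
    obtain ⟨P, hP⟩ := exists_periodStructure hx hT
    exact ⟨x, P, ⟨hT, rfl⟩, hP, 0, one_dvd _⟩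
  let S : ℕ → {s : ℕ × ℤ // 0 < s.1 ∧ DividesScale (closure (orbit x)) s.1} :=
    fun n => Nat.rec ⟨(1, 0), one_pos, hD1⟩ (fun _ s => nx s) n
  have hS : ∀ n, S (n+1) = nx (S n) := fun n => rfl
  -- base alphabet
  obtain ⟨k, ⟨e⟩⟩ := Finite.exists_equiv_fin (range x)
  let f : Fin k → A := fun b => (e.symm b).1
  have hf : Function.Injective f := Subtype.val_injective.comp e.symm.injective
  let y0 : ℤ → Fin k := fun i => e ⟨x i, i, rfl⟩
  have hxy : ∀ i, x i = f (y0 i) := fun i => by simp [f, y0]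
  have : Nonempty (Fin k) := ⟨y0 0⟩
  have hyS : ∀ n, Function.Surjective (Y (S n)) := by
    intro n
    have : ∃ j, Y (S n) j ≠ Y (S n) 0 := by
      by_contra hc
      push Not at hc
      obtain ⟨i, hi⟩ := per_int hx (nx (S n)).1.1 (by exact_mod_cast (nx (S n)).2.1)
      obtain ⟨j, t, t0, t1, rfl⟩ := blk (q := (nx (S n)).1.1)
        (by exact_mod_cast (nx (S n)).2.1) (nx (S n)).1.2 i
      apply hi
      have := (h4 (S n) (j+1) j).1 (by rw [hc, hc j]) t.toNat (by omega)
      rw [Int.toNat_of_nonneg t0] at this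
      rw [← this]
      congr 1; ring
    obtain ⟨j, hj⟩ := this
    intro b
    rcases Bool.eq_or_eq_not b (Y (S n) 0) with h | h
    · exact ⟨0, h.symm⟩
    · exact ⟨j, by rw [h]; exact Bool.eq_not_of_ne hj⟩
  obtain ⟨σ, a1, a2, a3, a4, a5, a6⟩ := tower_main hx hT (fun n => (S n).1.1) (fun n => (S n).1.2)
    (BB k) (BBy k y0 (fun n => Y (S n))) (fun n => (S n).2.1) (fun n => h1 _) (fun n => h2 _)
    (fun n => h3 _) (by
      intro n
      cases n with
      | zero =>
        intro j j'
        show y0 j = y0 j' ↔ ∀ t : ℕ, t < 1 → x (0 + j * (1:ℕ) + t) = x (0 + j' * (1:ℕ) + t)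
        constructor
        · intro h t ht
          obtain rfl : t = 0 := by omega
          simp [hxy, h]
        · intro h
          have := h 0 one_pos
          simp only [Nat.cast_one, mul_one, zero_add, Nat.cast_zero, add_zero, hxy] at this
          exact hf this
      | succ n => exact h4 (S n)) (fun n => h5 _) (fun n => h6 _) (by
      intro n
      cases n with
      | zero =>
        intro b
        obtain ⟨i, hi⟩ := (e.symm b).2
        refine ⟨i, hf ?_⟩
        show f (y0 i) = _
        rw [← hxy, hi]
      | succ n => exact hyS n) (by
        intro n (a : Bool) (b : Bool) (c : Bool)
        show a = b ∨ b = c ∨ a = c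
        revert a b c; decide)
  refine ⟨BB k, BB.fintype k, σ, a1, a2, a3, a4, a5, ?_, ?_⟩
  · intro N
    exact ⟨N + 1, by omega, le_of_eq Fintype.card_bool⟩
  · exact conj_lemma x f (Function.invFun f) (Function.leftInverse_invFun hf) y0 hxy _ a6

/-- `x` is cut into blocks of length `q` at phase `c`, at most two different blocks occur,
and the blocks coincide near the cuts. -/
def Cut (x : ℤ → A) (L q : ℕ) (c : ℤ) : Prop :=
  0 < q ∧ L ≤ q ∧
  (∀ (j j' t : ℤ), -(L : ℤ) ≤ t → t < L → x (c + j * q + t) = x (c + j' * q + t)) ∧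
  ∀ j₁ j₂ j₃ : ℤ,
    (∀ t : ℕ, t < q → x (c + j₁ * q + t) = x (c + j₂ * q + t)) ∨
    (∀ t : ℕ, t < q → x (c + j₂ * q + t) = x (c + j₃ * q + t)) ∨
    (∀ t : ℕ, t < q → x (c + j₁ * q + t) = x (c + j₃ * q + t))

theorem class_bound (x : ℤ → A) (P : ℕ) (hP : 0 < P) : ∃ T : ℕ, ∀ (r : ℤ) (a : A),
    (∀ k : ℤ, -(T : ℤ) ≤ r + k * P → r + k * P ≤ T → x (r + k * P) = a) →
    ∀ k : ℤ, x (r + k * P) = a := by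
  have h1 : ∀ r : ℕ, ∃ T : ℕ, ∀ a : A,
      (∀ k : ℤ, -(T : ℤ) ≤ r + k * P → r + k * P ≤ T → x (r + k * P) = a) →
      ∀ k : ℤ, x (r + k * P) = a := by
    intro r
    by_cases h : ∀ k : ℤ, x (r + k * P) = x r
    · refine ⟨r, fun a ha k => ?_⟩
      have := ha 0 (by omega) (by omega)
      simp only [zero_mul, add_zero] at this
      rw [h, this]
    · push Not at h
      obtain ⟨k0, hk0⟩ := h
      refine ⟨r + (r + k0 * P : ℤ).natAbs, fun a ha k => ?_⟩
      have h0 := ha 0 (by omega) (by omega)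
      have h1 := ha k0 (by omega) (by omega)
      simp only [zero_mul, add_zero] at h0
      exact absurd (h1.trans h0.symm) hk0
  choose T hT using h1
  refine ⟨(Finset.range P).sup T, fun r a ha k => ?_⟩
  obtain ⟨l, t, t0, t1, h2⟩ := blk (q := P) (by exact_mod_cast hP) 0 r
  lift t to ℕ using t0
  have h3 : T t ≤ (Finset.range P).sup T :=
    Finset.le_sup (f := T) (Finset.mem_range.2 (by exact_mod_cast t1))
  have h4 : ∀ k : ℤ, (t : ℤ) + k * P = r + (k - l) * P := by intro k; rw [h2]; ring
  have := hT t a (fun k h5 h6 => by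
    rw [h4] at *
    exact ha _ (by omega) (by omega)) (k + l)
  rwa [h4, add_sub_cancel_right] at this

theorem cut_dvd {x : ℤ → A} {P : ℕ → ℕ} (hP : IsPeriodStructure x P) (k : ℕ) :
    ∃ L0 : ℕ, ∀ (L q : ℕ) (c : ℤ), L0 ≤ L → Cut x L q c → P k ∣ q := by
  have hk0 := (hP.2.1 k).1
  obtain ⟨T, hT⟩ := class_bound x (P k) (by omega)
  obtain ⟨m, hkm, hm⟩ := hP.window (-(T : ℤ)) (2 * T + 1) k
  have hM : P k ∣ P m := hP.dvd_of_le hkm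
  have hm0 := (hP.2.1 m).1
  refine ⟨P m, fun L q c hL hC => ?_⟩
  have fwd : ∀ (s : ℤ) (a : A), Skel x (P k) s = some a → Skel x (P k) (s + q) = some a := by
    intro s a h
    rw [skel_some] at h
    obtain ⟨h1, rfl⟩ := h
    have key := hT (s + q) (x s) (by
      intro l hl1 hl2
      have hper := hm (s + q + l * P k + T).toNat (by omega)
      rw [Int.toNat_of_nonneg (by omega)] at hper
      rw [show -(T:ℤ) + (s + q + l * P k + T) = s + q + l * P k by ring] at hper
      obtain ⟨n, t, t0, t1, h2⟩ := blk (q := P m) (by omega) (c + q) (s + q + l * P k)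
      obtain ⟨e, he⟩ := hM
      rw [← hper (-n)]
      have h3 := hC.2.2.1 1 0 t (by omega) (by omega)
      rw [show s + q + l * P k + -n * P m = c + 1 * q + t by rw [h2]; ring, h3]
      rw [← h1 (l - n * e)]
      congr 1
      rw [he] at h2
      push_cast at h2
      linear_combination -h2)
    refine skel_some.2 ⟨fun l => ?_, ?_⟩
    · rw [key l]
      have := key 0
      simp only [zero_mul, add_zero] at this
      exact this.symm
    · have := key 0
      simpa using this
  have fwdn : ∀ (n : ℕ) (s : ℤ) (a : A), Skel x (P k) s = some a →
      Skel x (P k) (s + n * q) = some a := by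
    intro n
    induction n with
    | zero => intro s a h; simpa using h
    | succ n ih =>
      intro s a h
      have := fwd _ _ (ih s a h)
      rw [← this]; push_cast; congr 1; ring
  have per : ∀ s, Skel x (P k) (s + q) = Skel x (P k) s := by
    intro s
    apply opt_ext
    intro a
    refine ⟨fun h => ?_, fwd s a⟩
    have := fwdn (P k - 1) _ _ h
    rw [← this, ← skel_add s q, Nat.cast_sub (by omega)]
    congr 1; push_cast; ring
  exact_mod_cast (hP.2.1 k).dvd per

theorem cut_concl [TopologicalSpace A] [DiscreteTopology A] {x : ℤ → A} 
    (hx : IsAperiodicPoint x) (hT : IsToeplitz x) {P : ℕ → ℕ} (hP : IsPeriodStructure x P)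
    (hC : ∀ L, ∃ q c, Cut x L q c) (k : ℕ) (m : ℕ) :
    ∃ (q r : ℕ) (u v : List A), 0 < q ∧
          u.length = q ∧ v.length = q ∧
          P k ∣ q ∧ DividesScale (closure (orbit x)) q ∧ q < r ∧
          CommonPrefixLongerThan u v m ∧ CommonSuffixLongerThan u v m ∧
          ∀ w ∈ Lang (2*r) (closure (orbit x)) ∪ Lang (4*r) (closure (orbit x)), 
            UniquelyBuiltFrom {u, v} w := by
  classical
  obtain ⟨L0, hL0⟩ := cut_dvd hP k
  obtain ⟨q, c, hcut⟩ := hC (L0 + m + 1)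
  have hdvd := hL0 _ _ _ (by omega) hcut
  obtain ⟨hq, hLq, hedge, htwo⟩ := hcut
  obtain ⟨j1, hj1⟩ : ∃ j1 : ℤ, ∀ j : ℤ,
      (∀ t : ℕ, t < q → x (c + j * q + t) = x (c + 0 * q + t)) ∨
      (∀ t : ℕ, t < q → x (c + j * q + t) = x (c + j1 * q + t)) := by
    by_cases h : ∀ j : ℤ, ∀ t : ℕ, t < q → x (c + j * q + t) = x (c + 0 * q + t)
    · exact ⟨0, fun j => Or.inl (h j)⟩
    · rw [not_forall] at h
      obtain ⟨j1, h⟩ := h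
      refine ⟨j1, fun j => ?_⟩
      rcases htwo j 0 j1 with h1 | h1 | h1
      · exact Or.inl h1
      · exact absurd (fun t ht => (h1 t ht).symm) h
      · exact Or.inr h1
  have hG : GPh x q (factorAt x (c + 0 * q) q) (factorAt x (c + j1 * q) q) c := by
    intro j
    rcases hj1 j with h | h
    · exact ⟨_, Or.inl rfl, fun t ht => by rw [factorAt_getElem? _ _ _ _ ht, h t ht]⟩
    · exact ⟨_, Or.inr rfl, fun t ht => by rw [factorAt_getElem? _ _ _ _ ht, h t ht]⟩
  obtain ⟨N, hN⟩ := unique_window hx hT hq hG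
  have hqz : (0 : ℤ) < q := by exact_mod_cast hq
  have hub : ∀ (i : ℤ) (n : ℕ), N ≤ n → q ≤ n →
      UniquelyBuiltFrom {factorAt x (c + 0 * q) q, factorAt x (c + j1 * q) q} (factorAt x i n) := by
    intro i n hn hqn
    rw [uniquelyBuilt_iff (factorAt_length _ _ _) (factorAt_length _ _ _) hqn]
    have d0 := Int.emod_nonneg (c - i) hqz.ne'
    have d1 := Int.emod_lt_of_pos (c - i) hqz
    have d2 : (q : ℤ) ∣ (c - i) - (c - i) % q := Int.dvd_self_sub_emod
    refine ⟨((c - i) % q).toNat, ⟨by omega, (hG.ph i n).congr ?_⟩, ?_⟩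
    · rw [Int.toNat_of_nonneg d0, ← dvd_neg]
      exact dvd_conv d2 (by ring)
    · rintro k ⟨hk, hk'⟩
      have h3 := hN i n hn _ hk'
      have h4 : (q : ℤ) ∣ k - (c - i) % q := dvd_conv (dvd_add h3 d2) (by ring)
      obtain ⟨e, he⟩ := h4
      have he0 : e = 0 := by
        by_contra hne
        rcases lt_or_gt_of_ne hne with h | h
        · have : (q : ℤ) * e ≤ q * (-1) := mul_le_mul_of_nonneg_left (by omega) hqz.le
          omega
        · have : (q : ℤ) * 1 ≤ q * e := mul_le_mul_of_nonneg_left (by omega) hqz.le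
          omega
      rw [he0, mul_zero] at he
      omega
  refine ⟨q, max N q + 1, factorAt x (c + 0 * q) q, factorAt x (c + j1 * q) q, hq,
    factorAt_length _ _ _, factorAt_length _ _ _, hdvd, ?_, by omega, ?_, ?_, ?_⟩
  · obtain ⟨n, -, hn⟩ := hP.window 0 N 0
    refine ⟨x, P, ⟨hT, rfl⟩, hP, n, ?_⟩
    have h1 := (hG.ph (0 + (P n : ℤ)) N).translate (fun p p0 p1 => by
      have := hn p.toNat (by omega) 1
      rw [Int.toNat_of_nonneg p0] at this
      simpa using this)
    have h2 := hN 0 N le_rfl _ h1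
    rw [show c - (P n : ℤ) - c = -(P n : ℤ) by ring, dvd_neg] at h2
    exact_mod_cast h2
  · refine ⟨by rw [factorAt_length]; omega, by rw [factorAt_length]; omega, ?_⟩
    apply List.ext_getElem?
    intro t
    rw [List.getElem?_take, List.getElem?_take]
    split
    · rw [factorAt_getElem? _ _ _ _ (by omega), factorAt_getElem? _ _ _ _ (by omega),
        hedge 0 j1 t (by omega) (by omega)]
    · rfl
  · refine ⟨by rw [List.length_reverse, factorAt_length]; omega,
      by rw [List.length_reverse, factorAt_length]; omega, ?_⟩
    apply List.ext_getElem?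
    intro t
    rw [List.getElem?_take, List.getElem?_take]
    split
    · rw [List.getElem?_reverse (by rw [factorAt_length]; omega),
        List.getElem?_reverse (by rw [factorAt_length]; omega), factorAt_length, factorAt_length,
        factorAt_getElem? _ _ _ _ (by omega), factorAt_getElem? _ _ _ _ (by omega)]
      have := hedge (0 + 1) (j1 + 1) ((q - 1 - t : ℕ) - q) (by omega) (by omega)
      rw [show c + 0 * q + ((q - 1 - t : ℕ) : ℤ) = c + (0 + 1) * q + ((q - 1 - t : ℕ) - q) by ring,
        this]
      congr 2; ring
    · rfl
  · rintro w (hw | hw)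
    · obtain ⟨i, rfl⟩ := (mem_Lang _ _ _).1 hw
      exact hub _ _ (by omega) (by omega)
    · obtain ⟨i, rfl⟩ := (mem_Lang _ _ _).1 hw
      exact hub _ _ (by omega) (by omega)

theorem curtis {K : Type*} [TopologicalSpace K] [DiscreteTopology K] [TopologicalSpace A]
    [DiscreteTopology A] (Y : Set (ℤ → K)) [CompactSpace Y] (g : Y → A) (hg : Continuous g) :
    ∃ R : ℕ, ∀ w w' : Y, (∀ t : ℤ, -(R : ℤ) ≤ t → t ≤ R → w.1 t = w'.1 t) → g w = g w' := by
  let U : ℕ → Set Y := fun R =>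
    {w | ∀ w' : Y, (∀ t : ℤ, -(R : ℤ) ≤ t → t ≤ R → w.1 t = w'.1 t) → g w = g w'}
  have hU : ∀ R, IsOpen (U R) := by
    intro R
    rw [isOpen_iff_forall_mem_open]
    intro w hw
    refine ⟨⋂ t ∈ Finset.Icc (-(R : ℤ)) R, {w' : Y | w'.1 t = w.1 t}, ?_, ?_, ?_⟩
    · intro w' hw' w'' h
      have h0 : ∀ t : ℤ, -(R : ℤ) ≤ t → t ≤ R → w'.1 t = w.1 t := by
        intro t h1 h2
        simp only [mem_iInter, Finset.mem_Icc] at hw'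
        exact hw' t ⟨h1, h2⟩
      rw [← hw w' (fun t h1 h2 => (h0 t h1 h2).symm)]
      exact hw w'' (fun t h1 h2 => by rw [← h0 t h1 h2, h t h1 h2])
    · refine isOpen_biInter_finset fun t _ => ?_
      have hcn : Continuous fun w' : Y => w'.1 t :=
        (continuous_apply t).comp continuous_subtype_val
      exact (isOpen_discrete {w.1 t}).preimage hcn
    · simp
  have hcov : (univ : Set Y) ⊆ ⋃ R, U R := by
    intro w _
    have ho : IsOpen (g ⁻¹' {g w}) := (isOpen_discrete _).preimage hg
    obtain ⟨O, hO, hO'⟩ := isOpen_induced_iff.1 ho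
    have hwO : w.1 ∈ O := by
      have : w ∈ Subtype.val ⁻¹' O := by rw [hO']; rfl
      exact this
    obtain ⟨I, u, hu, hIu⟩ := isOpen_pi_iff.1 hO w.1 hwO
    refine mem_iUnion.2 ⟨I.sup Int.natAbs, fun w' hw' => ?_⟩
    have : w' ∈ Subtype.val ⁻¹' O := by
      apply hIu
      intro t ht
      have h1 : t.natAbs ≤ I.sup Int.natAbs := Finset.le_sup (f := Int.natAbs) ht
      rw [← hw' t (by omega) (by omega)]
      exact (hu t ht).2
    rw [hO'] at this
    exact (show g w' = g w from this).symm
  obtain ⟨R, hR⟩ := isCompact_univ.elim_directed_cover U hU hcov (by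
    intro a b
    refine ⟨max a b, ?_, ?_⟩
    · intro w hw w' h
      exact hw w' (fun t h1 h2 => h t (by omega) (by omega))
    · intro w hw w' h
      exact hw w' (fun t h1 h2 => h t (by omega) (by omega)))
  exact ⟨R, fun w w' => hR (mem_univ w) w'⟩

theorem flatMap_index {f : B → List A} {H : ℕ} (hf : ∀ b, (f b).length = H) (l : List B) (j t : ℕ)
    (hj : j < l.length) (ht : t < H) : (l.flatMap f)[j * H + t]? = (f l[j])[t]? := by
  induction l generalizing j with
  | nil => simp at hj
  | cons a l ih =>
    rw [List.flatMap_cons]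
    cases j with
    | zero => rw [zero_mul, zero_add, List.getElem?_append_left (by rw [hf]; exact ht)]; rfl
    | succ j =>
      rw [List.getElem?_append_right (by rw [hf]; nlinarith), hf,
        show (j + 1) * H + t - H = j * H + t by rw [Nat.succ_mul]; omega,
        ih j (by simpa using hj)]
      simp

section Sadic

variable {B : ℕ → Type} (σ : ∀ n, B (n+1) → List (B n))

theorem sadic_cast_aux {j k : ℕ} (h : j = k) (a : B (j+1)) (g : B k → List (B 0)) :
    (σ j a).flatMap (fun b => g (cast (congrArg B h) b)) =
      (σ k (cast (congrArg (fun n => B (n+1)) h) a)).flatMap g := by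
  subst h; rfl

theorem sadic_word0 (k : ℕ) (a : B (0 + k)) :
    sadicWordAux σ 0 k a = word0 σ k (cast (congrArg B (Nat.zero_add k)) a) := by
  induction k with
  | zero => rfl
  | succ k ih =>
    show (σ (0 + k) a).flatMap (sadicWordAux σ 0 k) = (σ k _).flatMap (word0 σ k)
    rw [show sadicWordAux σ 0 k = fun b => word0 σ k (cast (congrArg B (Nat.zero_add k)) b) from funext ih]
    exact sadic_cast_aux σ (Nat.zero_add k) a (word0 σ k)

theorem mem_XLevel_word0 {y : ℤ → B 0} (hy : y ∈ XLevel σ 0) (i : ℤ) (m : ℕ) :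
    ∃ k, ∃ a : B k, factorAt y i m <:+: word0 σ k a := by
  obtain ⟨k, -, a, h⟩ := hy i m
  rw [sadic_word0] at h
  exact ⟨k, _, h⟩

theorem word0_dec {n k : ℕ} (h : n ≤ k) (a : B k) :
    ∃ l : List (B n), word0 σ k a = l.flatMap (word0 σ n) := by
  induction k, h using Nat.le_induction with
  | base => exact ⟨[a], by simp⟩
  | succ k _ ih =>
    choose f hf using ih
    refine ⟨(σ k a).flatMap f, ?_⟩
    show (σ k a).flatMap (word0 σ k) = _
    rw [List.flatMap_assoc, show word0 σ k = fun x => (f x).flatMap (word0 σ n) from funext hf]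

theorem length_flatMap_const {B' : Type*} {f : B' → List A} {H : ℕ} (hf : ∀ b, (f b).length = H)
    (l : List B') : (l.flatMap f).length = l.length * H := by
  induction l with
  | nil => simp
  | cons a l ih => rw [List.flatMap_cons, List.length_append, hf, ih, List.length_cons]; ring

/-- Heights of the words. -/
theorem exists_heights (hne : NonErasing σ) (hcl : ConstantLength σ) (hnon : ∀ n, Nonempty (B n)) :
    ∃ H : ℕ → ℕ, (∀ n, 0 < H n) ∧ (∀ n, H n ≤ H (n+1)) ∧
      ∀ n a, (word0 σ n a).length = H n := by
  have key : ∀ n, ∃ h, 0 < h ∧ ∀ a, (word0 σ n a).length = h := by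
    intro n
    induction n with
    | zero => exact ⟨1, one_pos, fun a => rfl⟩
    | succ n ih =>
      obtain ⟨h, h0, hh⟩ := ih
      obtain ⟨a0⟩ := hnon (n+1)
      refine ⟨(σ n a0).length * h, Nat.mul_pos (List.length_pos_of_ne_nil (hne n a0)) h0,
        fun a => ?_⟩
      show ((σ n a).flatMap (word0 σ n)).length = _
      rw [length_flatMap_const hh, hcl n a a0]
  choose H h0 hH using key
  refine ⟨H, h0, fun n => ?_, hH⟩
  obtain ⟨a⟩ := hnon (n+1)
  rw [← hH (n+1) a]
  show _ ≤ ((σ n a).flatMap (word0 σ n)).length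
  rw [length_flatMap_const (hH n)]
  exact Nat.le_mul_of_pos_left _ (List.length_pos_of_ne_nil (hne n a))

theorem word0_pre (hp : ProperSeq σ) {H : ℕ → ℕ} (hH : ∀ n a, (word0 σ n a).length = H n) (n : ℕ)
    (a a' : B (n+1)) (t : ℕ) (ht : t < H n) :
    (word0 σ (n+1) a)[t]? = (word0 σ (n+1) a')[t]? := by
  obtain ⟨b, c, h⟩ := hp n
  have key : ∀ a, (word0 σ (n+1) a)[t]? = (word0 σ n b)[t]? := by
    intro a
    obtain ⟨l, hl⟩ := List.head?_eq_some_iff.1 (h a).1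
    show ((σ n a).flatMap (word0 σ n))[t]? = _
    rw [hl, List.flatMap_cons, List.getElem?_append_left (by rw [hH]; exact ht)]
  rw [key, key]

theorem word0_suf (hp : ProperSeq σ) {H : ℕ → ℕ} (hH : ∀ n a, (word0 σ n a).length = H n) (n : ℕ)
    (a a' : B (n+1)) (t : ℕ) (ht : H (n+1) ≤ t + H n) :
    (word0 σ (n+1) a)[t]? = (word0 σ (n+1) a')[t]? := by
  obtain ⟨b, c, h⟩ := hp n
  have key : ∀ a, (word0 σ (n+1) a)[t]? = (word0 σ n c)[t + H n - H (n+1)]? := by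
    intro a
    obtain ⟨l, hl⟩ := List.getLast?_eq_some_iff.1 (h a).2
    have e : word0 σ (n+1) a = l.flatMap (word0 σ n) ++ word0 σ n c := by
      show (σ n a).flatMap (word0 σ n) = _
      rw [hl, List.flatMap_append]; simp
    have e2 := congrArg List.length e
    rw [List.length_append, hH, hH] at e2
    rw [e, List.getElem?_append_right (by omega)]
    congr 1; omega
  rw [key, key]

theorem exists_cut {H : ℕ → ℕ} (h0 : ∀ n, 0 < H n)
    (hmono : ∀ n, H n ≤ H (n+1)) (hH : ∀ n a, (word0 σ n a).length = H n)
    (hnon : ∀ n, Nonempty (B n)) {y : ℤ → B 0} (hy : y ∈ XLevel σ 0) (n : ℕ) :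
    ∃ (c : ℤ) (b : ℤ → B n), ∀ (j : ℤ) (t : ℕ), t < H n →
      (word0 σ n (b j))[t]? = some (y (c + j * H n + t)) := by
  have hHm : Monotone H := monotone_nat_of_le_succ hmono
  have hpos := h0 n
  have hposz : (0 : ℤ) < H n := by exact_mod_cast hpos
  let Q : ℕ → Fin (H n) → Prop := fun s d => ∀ j : ℤ, ∃ b : B n, ∀ t : ℕ, t < H n →
    -(s : ℤ) ≤ (d : ℕ) + j * H n + t → (d : ℕ) + j * H n + t < s →
      (word0 σ n b)[t]? = some (y ((d : ℕ) + j * H n + t))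
  have hQ : ∀ s, ∃ d, Q s d := by
    intro s
    obtain ⟨k, a, p, r, hpr⟩ := mem_XLevel_word0 σ hy (-((s + H n : ℕ) : ℤ)) (2 * (s + H n))
    have hnk : n ≤ k := by
      by_contra hc
      have h1 := congrArg List.length hpr
      simp only [List.length_append, factorAt_length, hH] at h1
      have := hHm (show k ≤ n by omega)
      omega
    obtain ⟨l, hl⟩ := word0_dec σ hnk a
    rw [hl] at hpr
    have hlen := congrArg List.length hpr
    simp only [List.length_append, factorAt_length, length_flatMap_const (hH n)] at hlen
    set c : ℤ := -((s + H n : ℕ) : ℤ) - p.length with hc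
    have d0 := Int.emod_nonneg c hposz.ne'
    have d1 := Int.emod_lt_of_pos c hposz
    have d2 := Int.mul_ediv_add_emod c (H n)
    refine ⟨⟨(c % H n).toNat, by omega⟩, fun j => ?_⟩
    simp only [Int.toNat_of_nonneg d0]
    obtain ⟨b0⟩ := hnon n
    -- block index in `l`
    have e : c % H n + j * H n = c + (j - c / H n) * H n := by linear_combination d2
    rw [e]
    generalize j - c / H n = i
    by_cases hi : 0 ≤ i ∧ i < l.length
    · obtain ⟨i0, i1⟩ := hi
      lift i to ℕ using i0
      refine ⟨l[i]'(by exact_mod_cast i1), fun t ht a1 a2 => ?_⟩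
      rw [← flatMap_index (hH n) l i t _ ht, ← hpr]
      have a3 : p.length ≤ i * H n + t := by zify; omega
      rw [List.append_assoc, List.getElem?_append_right a3]
      have a4 : i * H n + t - p.length < 2 * (s + H n) := by
        zify [a3]; push_cast at *; omega
      rw [List.getElem?_append_left (by rw [factorAt_length]; exact a4),
        factorAt_getElem? _ _ _ _ a4]
      congr 2
      rw [Nat.cast_sub a3, hc]; push_cast; ring
    · refine ⟨b0, fun t ht a1 a2 => ?_⟩
      exfalso
      apply hi
      have hlenz : (p.length : ℤ) + 2 * (s + H n) + r.length = l.length * H n := by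
        exact_mod_cast hlen
      push_cast at hc
      constructor
      · by_contra h
        have : i * H n ≤ (-1) * H n := mul_le_mul_of_nonneg_right (by omega) hposz.le
        omega
      · by_contra h
        have : (l.length : ℤ) * H n ≤ i * H n := mul_le_mul_of_nonneg_right (by omega) hposz.le
        omega
  obtain ⟨d, hd⟩ := pigeon Q (by
    intro s s' d hs h j
    obtain ⟨b, hb⟩ := h j
    exact ⟨b, fun t ht h1 h2 => hb t ht (by omega) (by omega)⟩) hQ
  refine ⟨(d : ℕ), ?_⟩
  have : ∀ j : ℤ, ∃ b : B n, ∀ t : ℕ, t < H n →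
      (word0 σ n b)[t]? = some (y (((d : ℕ) : ℤ) + j * H n + t)) := by
    intro j
    obtain ⟨b, hb⟩ := hd ((((d : ℕ) : ℤ) + j * H n).natAbs + H n) j
    exact ⟨b, fun t ht => hb t ht (by omega) (by omega)⟩
  choose b hb using this
  exact ⟨b, hb⟩

end Sadic

theorem forward_cut [Finite A] [TopologicalSpace A] [DiscreteTopology A] {x : ℤ → A} 
    (hx : IsAperiodicPoint x) (h : IsStrongToeplitzOfRank (closure (orbit x)) 2) (L : ℕ) :
    ∃ q c, Cut x L q c := by
  obtain ⟨B, iB, σ, hne, hcl, -, hpr, -, hrank, φ, hφ⟩ := h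
  let _ : TopologicalSpace (B 0) := ⊥
  have _ : DiscreteTopology (B 0) := ⟨rfl⟩
  have hnon : ∀ n, Nonempty (B n) := fun n => ⟨(hpr n).choose⟩
  obtain ⟨H, h0, hmono, hH⟩ := exists_heights σ hne hcl hnon
  have _ : CompactSpace (closure (orbit x)) :=
    isCompact_iff_compactSpace.1 isClosed_closure.isCompact
  have _ : CompactSpace (XLevel σ 0) := φ.compactSpace
  have hmem : ∀ k : ℤ, shiftBy k x ∈ closure (orbit x) := fun k => subset_closure ⟨k, rfl⟩
  obtain ⟨R, hR⟩ := curtis (XLevel σ 0) (fun w => (φ.symm w).1 0)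
    ((continuous_apply (0 : ℤ)).comp (continuous_subtype_val.comp φ.symm.continuous))
  set y : ℤ → B 0 := (φ ⟨shiftBy 0 x, hmem 0⟩).1 with hy
  have hF : ∀ k : ℤ, (φ ⟨shiftBy (k + 1) x, hmem _⟩).1 = shift (φ ⟨shiftBy k x, hmem k⟩).1 := by
    intro k
    have e : shiftBy (k + 1) x = shift (shiftBy k x) := by
      funext i; show x _ = x _; congr 1; ring
    have := hφ (shiftBy k x) (hmem k) (by rw [← e]; exact hmem _)
    rw [← this]
    congr 3
  have hF' : ∀ k i : ℤ, (φ ⟨shiftBy k x, hmem k⟩).1 i = y (i + k) := by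
    intro k
    induction k using Int.induction_on with
    | zero => intro i; rw [hy, add_zero]
    | succ k ih =>
      intro i
      rw [hF, shift, ih]
      congr 1; ring
    | pred k ih =>
      intro i
      have := congrFun (hF (-(k:ℤ) - 1)) (i - 1)
      simp only [shift, sub_add_cancel] at this
      rw [← this, ih]
      congr 1; ring
  have code : ∀ k k' : ℤ, (∀ t : ℤ, -(R : ℤ) ≤ t → t ≤ R → y (k + t) = y (k' + t)) →
      x k = x k' := by
    intro k k' hk
    have := hR (φ ⟨shiftBy k x, hmem k⟩) (φ ⟨shiftBy k' x, hmem k'⟩) (fun t t0 t1 => by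
      rw [hF', hF', add_comm, hk t t0 t1, add_comm])
    simpa [shiftBy] using this
  have hyX : y ∈ XLevel σ 0 := (φ ⟨shiftBy 0 x, hmem 0⟩).2
  -- the cuts of `y`
  have hcut : ∀ n, ∃ (c : ℤ) (b : ℤ → B (n+1)),
      (∀ j j', b j = b j' → ∀ t : ℕ, t < H (n+1) →
        y (c + j * H (n+1) + t) = y (c + j' * H (n+1) + t)) ∧
      (∀ (j j' : ℤ) (t : ℕ), t < H n → y (c + j * H (n+1) + t) = y (c + j' * H (n+1) + t)) ∧
      (∀ (j j' : ℤ) (t : ℕ), t < H (n+1) → H (n+1) ≤ t + H n →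
        y (c + j * H (n+1) + t) = y (c + j' * H (n+1) + t)) := by
    intro n
    obtain ⟨c, b, hb⟩ := exists_cut σ h0 hmono hH hnon hyX (n+1)
    have hm := hmono n
    refine ⟨c, b, fun j j' e t ht => ?_, fun j j' t ht => ?_, fun j j' t ht ht' => ?_⟩
    · apply Option.some.inj
      rw [← hb _ _ ht, ← hb _ _ ht, e]
    · apply Option.some.inj
      rw [← hb j t (by omega), ← hb j' t (by omega)]
      exact word0_pre σ hpr hH n _ _ t ht
    · apply Option.some.inj
      rw [← hb j t (by omega), ← hb j' t (by omega)]
      exact word0_suf σ hpr hH n _ _ t ht'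
  have hlt : ∀ n, H n < H (n+1) := by
    intro n
    refine lt_of_le_of_ne (hmono n) fun e => ?_
    obtain ⟨c, b, -, h1, -⟩ := hcut n
    have hp : (0 : ℤ) < H (n+1) := by exact_mod_cast h0 (n+1)
    obtain ⟨i, hi⟩ := per_int hx (H (n+1)) hp
    apply hi
    apply code
    intro t _ _
    obtain ⟨j, s, s0, s1, hs⟩ := blk hp c (i + t)
    have := h1 (j + 1) j s.toNat (by omega)
    rw [Int.toNat_of_nonneg s0] at this
    rw [hs, ← this, show i + (H (n+1) : ℤ) + t = i + t + H (n+1) by ring, hs]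
    congr 1; ring
  have hge : ∀ n, n ≤ H n := (strictMono_nat_of_lt_succ hlt).id_le
  obtain ⟨n, hn, hcard⟩ := hrank (L + R + 1)
  obtain ⟨n, rfl⟩ : ∃ n', n = n' + 1 := ⟨n - 1, by omega⟩
  have hHn : L + R ≤ H n := le_trans (by omega) (hge n)
  have hn1 := hmono n
  obtain ⟨c, b, h1, h2, h3⟩ := hcut n
  have edge : ∀ (j j' t : ℤ), -(H n : ℤ) ≤ t → t < H n →
      y (c + j * H (n+1) + t) = y (c + j' * H (n+1) + t) := by
    intro j j' t t0 t1
    by_cases ht : 0 ≤ t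
    · have := h2 j j' t.toNat (by omega)
      rwa [Int.toNat_of_nonneg ht] at this
    · have := h3 (j - 1) (j' - 1) (t + H (n+1)).toNat (by omega) (by omega)
      rw [Int.toNat_of_nonneg (by omega)] at this
      rw [show c + j * H (n+1) + t = c + (j - 1) * H (n+1) + (t + H (n+1)) by ring, this]
      congr 1; ring
  have blkeq : ∀ j j', b j = b j' → ∀ t : ℕ, t < H (n+1) →
      x (c + j * H (n+1) + t) = x (c + j' * H (n+1) + t) := by
    intro j j' e t ht
    apply code
    intro s s0 s1
    rw [add_assoc _ (t : ℤ), add_assoc _ (t : ℤ)]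
    by_cases c1 : (t : ℤ) + s < H n
    · exact edge _ _ _ (by omega) c1
    · by_cases c2 : (t : ℤ) + s < H (n+1)
      · have := h1 j j' e (t + s : ℤ).toNat (by omega)
        rwa [Int.toNat_of_nonneg (by omega)] at this
      · have := edge (j + 1) (j' + 1) (t + s - H (n+1)) (by omega) (by omega)
        rw [show c + j * H (n+1) + (t + s) = c + (j + 1) * H (n+1) + (t + s - H (n+1)) by ring,
          this]
        congr 1; ring
  refine ⟨H (n+1), c, h0 _, by omega, ?_, ?_⟩
  · intro j j' t t0 t1
    apply code
    intro s s0 s1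
    rw [add_assoc _ t, add_assoc _ t]
    exact edge _ _ _ (by omega) (by omega)
  · intro j₁ j₂ j₃
    have hthree : b j₁ = b j₂ ∨ b j₂ = b j₃ ∨ b j₁ = b j₃ := by
      by_contra hc
      push Not at hc
      classical
      have : ({b j₁, b j₂, b j₃} : Finset (B (n+1))).card = 3 :=
        Finset.card_eq_three.2 ⟨_, _, _, hc.1, hc.2.2, hc.2.1, rfl⟩
      have h4 := Finset.card_le_univ ({b j₁, b j₂, b j₃} : Finset (B (n+1)))
      omega
    rcases hthree with e | e | e
    · exact Or.inl (blkeq _ _ e)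
    · exact Or.inr (Or.inl (blkeq _ _ e))
    · exact Or.inr (Or.inr (blkeq _ _ e))

theorem main_aux [Finite A] [TopologicalSpace A] [DiscreteTopology A]
    (X : Set (ℤ → A)) (hX : IsToeplitzSubshift X)
    (hap : ∀ x ∈ X, IsAperiodicPoint x) :
    IsStrongToeplitzOfRank X 2 ↔
      ∀ p : ℕ, 0 < p → DividesScale X p → ∀ m : ℕ,
        ∃ (q r : ℕ) (u v : List A), 0 < q ∧
          u.length = q ∧ v.length = q ∧
          p ∣ q ∧ DividesScale X q ∧ q < r ∧
          CommonPrefixLongerThan u v m ∧ CommonSuffixLongerThan u v m ∧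
          ∀ w ∈ Lang (2*r) X ∪ Lang (4*r) X, UniquelyBuiltFrom {u, v} w := by
  have hself : ∀ x : ℤ → A, x ∈ closure (orbit x) := fun x =>
    subset_closure ⟨0, funext fun i => by simp [shiftBy]⟩
  constructor
  · rintro h p - ⟨x, P, ⟨hT, rfl⟩, hP, k, hk⟩ m
    have hx := hap x (hself x)
    obtain ⟨q, r, u, v, h1, h2, h3, h4, h5⟩ := cut_concl hx hT hP (forward_cut hx h) k m
    exact ⟨q, r, u, v, h1, h2, h3, hk.trans h4, h5⟩
  · intro hR
    obtain ⟨x, hT, rfl⟩ := hX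
    exact backward (hap x (hself x)) hT hR

/-- An aperiodic Toeplitz subshift `X` is a strong Toeplitz subshift of
rank 2 iff for every `p` dividing the scale of `X` and every `m` there are `q < r` and
words `u, v` of length `q` with `p ∣ q`, `q` dividing the scale, common prefix and
suffix longer than `m`, such that every word of `L_{2r}(X) ∪ L_{4r}(X)` is uniquely
built from `{u, v}`. -/
theorem statement8 {A : Type*} [Fintype A] [TopologicalSpace A] [DiscreteTopology A]
    (X : Set (ℤ → A)) (hX : IsToeplitzSubshift X)
    (hap : ∀ x ∈ X, IsAperiodicPoint x) :
    IsStrongToeplitzOfRank X 2 ↔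
      ∀ p : ℕ, 0 < p → DividesScale X p → ∀ m : ℕ,
        ∃ (q r : ℕ) (u v : List A), 0 < q ∧
          u.length = q ∧ v.length = q ∧
          p ∣ q ∧ DividesScale X q ∧ q < r ∧
          CommonPrefixLongerThan u v m ∧ CommonSuffixLongerThan u v m ∧
          ∀ w ∈ Lang (2*r) X ∪ Lang (4*r) X, UniquelyBuiltFrom {u, v} w := by
  exact main_aux X hX hap

end ToeplitzFR
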